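/- arXiv:1808.06157 — 4 statements merged into one kernel-verified Lean document; each statement's English description precedes it below -/
import Mathlib

section
/- Let n ≥ 4 and q ≥ 2 be integers, let (r_1,…,r_n), (c_1,…,c_n) ∈ (ℤ/qℤ)^n with Σ r_i = Σ c_j, and let x ∈ Ω. Let c be a real number with c ≥ 640/log log(16n). If t is a nonnegative integer with t ≥ (n²/(4(1−cos(2π/q))))·log n + (n²/(1−cos(2π/q)))·c·log log(16n)·√(log n)·log q, then ‖law(B_t) − Uniform(Ω)‖_TV ≤ q^{−c}, where B_t is the Diaconis–Gangolli chain started at x. -/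
/-- The matrix `A_{i,j,k,l}` (1-based indices). -/
def DGmat (n q : ℕ) (i j k l : ℕ) : Matrix (Fin n) (Fin n) (ZMod q) :=
  Matrix.of fun a b =>
    (if (a : ℕ) + 1 = i ∧ (b : ℕ) + 1 = k then (1 : ZMod q) else 0)
  + (if (a : ℕ) + 1 = j ∧ (b : ℕ) + 1 = l then 1 else 0)
  - (if (a : ℕ) + 1 = i ∧ (b : ℕ) + 1 = l then 1 else 0)
  - (if (a : ℕ) + 1 = j ∧ (b : ℕ) + 1 = k then 1 else 0)

/-- The step distribution μ of the Diaconis–Gangolli walk. -/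
noncomputable def stepPMF (n q : ℕ) (g : Matrix (Fin n) (Fin n) (ZMod q)) : ℝ :=
  (((((Finset.Icc 1 n ×ˢ Finset.Icc 1 n) ×ˢ (Finset.Icc 1 n ×ˢ Finset.Icc 1 n)) ×ˢ
        (Finset.univ : Finset Bool)).filter
      (fun p => p.1.1.1 < p.1.1.2 ∧ p.1.2.1 < p.1.2.2 ∧
        (if p.2 then DGmat n q p.1.1.1 p.1.1.2 p.1.2.1 p.1.2.2
         else - DGmat n q p.1.1.1 p.1.1.2 p.1.2.1 p.1.2.2) = g)).card : ℝ)
    / (2 * (n.choose 2 : ℝ) ^ 2)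

/-- law of `B_t = x + X_1 + ⋯ + X_t`, `X_i` i.i.d. with law μ. -/
noncomputable def walkDist (n q : ℕ) [NeZero q] (x : Matrix (Fin n) (Fin n) (ZMod q)) :
    ℕ → Matrix (Fin n) (Fin n) (ZMod q) → ℝ
  | 0 => fun z => if z = x then 1 else 0
  | t + 1 => fun z =>
      ∑ g : Matrix (Fin n) (Fin n) (ZMod q), walkDist n q x t g * stepPMF n q (z - g)

/-- Contingency tables with row sums `r` and column sums `c`. -/
def OmegaSet (n q : ℕ) [NeZero q] (r c : Fin n → ZMod q) :
    Finset (Matrix (Fin n) (Fin n) (ZMod q)) :=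
  Finset.univ.filter fun A => (∀ i, ∑ j, A i j = r i) ∧ (∀ j, ∑ i, A i j = c j)

/-- Uniform distribution on `OmegaSet`. -/
noncomputable def unifOmega (n q : ℕ) [NeZero q] (r c : Fin n → ZMod q)
    (z : Matrix (Fin n) (Fin n) (ZMod q)) : ℝ :=
  if z ∈ OmegaSet n q r c then 1 / ((OmegaSet n q r c).card : ℝ) else 0

/-- Total variation distance. -/
noncomputable def tvDist {X : Type*} [Fintype X] (ν π : X → ℝ) : ℝ :=
  (1 / 2) * ∑ z, |ν z - π z|

/-- The alternating sum of the four corners of a rectangle in a matrix. -/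
def rectSum {n q : ℕ} (Y : Matrix (Fin n) (Fin n) (ZMod q)) (i j k l : Fin n) : ZMod q :=
  Y i k + Y j l - Y i l - Y j k

/-- Matrices of the form `a i + b k`, i.e. those with vanishing rectangle sums. -/
def IsAdditive {n q : ℕ} (Y : Matrix (Fin n) (Fin n) (ZMod q)) : Prop :=
  ∀ i j k l, rectSum Y i j k l = 0

/-- The number of nonzero entries, as a real number. -/
noncomputable def weight {n q : ℕ} (Y : Matrix (Fin n) (Fin n) (ZMod q)) : ℝ :=
  ∑ i, ∑ k, if Y i k = 0 then 0 else 1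

/-- `Y` has the least weight in its class modulo additive matrices. -/
def IsMinimal {n q : ℕ} (Y : Matrix (Fin n) (Fin n) (ZMod q)) : Prop :=
  ∀ K, IsAdditive K → weight Y ≤ weight (Y + K)

/-- The number of (ordered) rectangles with nonzero rectangle sum. -/
noncomputable def rectCount {n q : ℕ} (Y : Matrix (Fin n) (Fin n) (ZMod q)) : ℝ :=
  ∑ i, ∑ j, ∑ k, ∑ l, if rectSum Y i j k l = 0 then 0 else 1

section Combinatorics

variable {n q : ℕ} {Y : Matrix (Fin n) (Fin n) (ZMod q)}

theorem IsMinimal.sq_mul_weight_le (hY : IsMinimal Y) : (n : ℝ) ^ 2 * weight Y ≤ rectCount Y := by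
  have h : ∀ j l, weight Y ≤ ∑ i, ∑ k, if rectSum Y i j k l = 0 then (0 : ℝ) else 1 := by
    intro j l
    refine (hY (Matrix.of fun i k => Y j l - Y i l - Y j k) ?_).trans (le_of_eq ?_)
    · intro a b c d
      simp only [rectSum, Matrix.of_apply]
      ring
    · unfold weight
      refine Finset.sum_congr rfl fun i _ => Finset.sum_congr rfl fun k _ => ?_
      have : (Y + Matrix.of fun i k => Y j l - Y i l - Y j k) i k = rectSum Y i j k l := by
        simp only [rectSum, Matrix.add_apply, Matrix.of_apply]
        ring
      rw [this]
  calc (n : ℝ) ^ 2 * weight Y = ∑ _j : Fin n, ∑ _l : Fin n, weight Y := by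
        simp; ring
    _ ≤ ∑ j, ∑ l, ∑ i, ∑ k, if rectSum Y i j k l = 0 then (0 : ℝ) else 1 :=
        Finset.sum_le_sum fun j _ => Finset.sum_le_sum fun l _ => h j l
    _ = rectCount Y := by
        unfold rectCount
        rw [Finset.sum_comm]
        simp_rw [fun l => Finset.sum_comm (s := Finset.univ (α := Fin n)) (t := Finset.univ)
          (f := fun j i => ∑ k, if rectSum Y i j k l = 0 then (0 : ℝ) else 1)]
        rw [Finset.sum_comm]
        refine Finset.sum_congr rfl fun i _ => ?_
        rw [Finset.sum_comm]
        exact Finset.sum_congr rfl fun j _ => Finset.sum_comm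

theorem IsMinimal.transpose (hY : IsMinimal Y) : IsMinimal Y.transpose := by
  have hw : ∀ Z : Matrix (Fin n) (Fin n) (ZMod q), weight Z.transpose = weight Z := fun Z =>
    Finset.sum_comm
  intro K hK
  have := hY K.transpose fun i j k l => by
    have := hK k l i j
    simp only [rectSum, Matrix.transpose_apply] at this ⊢
    rw [← this]; ring
  rw [hw, ← hw (Y.transpose + K)]
  simpa using this

theorem IsMinimal.row_le (hY : IsMinimal Y) (i : Fin n) (c : ZMod q) :
    ∑ l, (if Y i l = 0 then (0 : ℝ) else 1) ≤ ∑ l, if Y i l = c then (0 : ℝ) else 1 := by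
  have h := hY (Matrix.of fun i' _ => if i' = i then -c else 0) fun a b d e => by
    simp [rectSum]
  unfold weight at h
  rw [← Finset.add_sum_erase _ _ (Finset.mem_univ i),
    ← Finset.add_sum_erase Finset.univ (fun x => ∑ k, _) (Finset.mem_univ i)] at h
  have h2 : ∑ x ∈ Finset.univ.erase i, ∑ k, (if (Y + (Matrix.of fun i' _ => if i' = i then -c else 0 : Matrix (Fin n) (Fin n) (ZMod q))) x k = 0 then (0 : ℝ) else 1)
      = ∑ x ∈ Finset.univ.erase i, ∑ k, (if Y x k = 0 then (0 : ℝ) else 1) := by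
    refine Finset.sum_congr rfl fun x hx => ?_
    simp [Finset.ne_of_mem_erase hx]
  rw [h2] at h
  have h3 := le_of_add_le_add_right h
  simpa [add_neg_eq_zero] using h3

theorem IsMinimal.row_pairs (hY : IsMinimal Y) (i : Fin n) :
    n * ∑ l, (if Y i l = 0 then (0 : ℝ) else 1) ≤ ∑ k, ∑ l, if Y i k = Y i l then (0 : ℝ) else 1 := by
  calc n * ∑ l, (if Y i l = 0 then (0 : ℝ) else 1)
      = ∑ _k : Fin n, ∑ l, (if Y i l = 0 then (0 : ℝ) else 1) := by simp
    _ ≤ _ := Finset.sum_le_sum fun k _ => by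
        simpa only [eq_comm] using hY.row_le i (Y i k)

theorem IsMinimal.col_pairs (hY : IsMinimal Y) (k : Fin n) :
    n * ∑ i, (if Y i k = 0 then (0 : ℝ) else 1) ≤ ∑ i, ∑ j, if Y i k = Y j k then (0 : ℝ) else 1 :=
  hY.transpose.row_pairs k

theorem sum_corner_indicators_le {R : Type*} [AddCommGroup R] [DecidableEq R] (a b c d : R)
    (I J K L : Prop) [Decidable I] [Decidable J] [Decidable K] [Decidable L] :
    (if I ∧ a ≠ b ∧ c = 0 ∧ d = 0 then (1 : ℝ) else 0)
      + (if J ∧ c ≠ d ∧ a = 0 ∧ b = 0 then 1 else 0)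
      + (if K ∧ ¬I ∧ ¬J ∧ a ≠ c ∧ b = 0 ∧ d = 0 then 1 else 0)
      + (if L ∧ ¬I ∧ ¬J ∧ b ≠ d ∧ a = 0 ∧ c = 0 then 1 else 0)
      + (if ¬I ∧ ¬K ∧ a ≠ 0 ∧ b = 0 ∧ c = 0 ∧ d = 0 then 1 else 0)
      + (if ¬J ∧ ¬K ∧ c ≠ 0 ∧ d = 0 ∧ a = 0 ∧ b = 0 then 1 else 0)
      + (if ¬I ∧ ¬L ∧ b ≠ 0 ∧ a = 0 ∧ d = 0 ∧ c = 0 then 1 else 0)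
      + (if ¬J ∧ ¬L ∧ d ≠ 0 ∧ c = 0 ∧ b = 0 ∧ a = 0 then 1 else 0)
      ≤ if a + d - b - c = 0 then 0 else 1 := by
  by_cases hs : a + d - b - c = 0
  · have h₁ : c = 0 → d = 0 → a = b := by rintro rfl rfl; simpa [sub_eq_zero] using hs
    have h₂ : a = 0 → b = 0 → c = d := by rintro rfl rfl; simpa [sub_eq_zero, eq_comm] using hs
    have h₃ : b = 0 → d = 0 → a = c := by rintro rfl rfl; simpa [sub_eq_zero] using hs
    have h₄ : a = 0 → c = 0 → b = d := by rintro rfl rfl; simpa [sub_eq_zero, eq_comm] using hs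
    rw [if_pos hs]
    repeat rw [if_neg (by grind)]
    simp
  · rw [if_neg hs]
    by_cases ha : a = 0 <;> by_cases hb : b = 0 <;> by_cases hc : c = 0 <;> by_cases hd : d = 0 <;>
      simp [ha, hb, hc, hd] <;> grind

theorem two_mul_sum_le_rectCount (H K : Finset (Fin n)) :
    2 * (∑ i, ∑ j, ∑ k, ∑ l,
        if i ∈ H ∧ Y i k ≠ Y i l ∧ Y j k = 0 ∧ Y j l = 0 then (1 : ℝ) else 0)
      + 2 * (∑ i, ∑ j, ∑ k, ∑ l,
        if k ∈ K ∧ i ∉ H ∧ j ∉ H ∧ Y i k ≠ Y j k ∧ Y i l = 0 ∧ Y j l = 0 then (1 : ℝ) else 0)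
      + 4 * (∑ i, ∑ j, ∑ k, ∑ l,
        if i ∉ H ∧ k ∉ K ∧ Y i k ≠ 0 ∧ Y i l = 0 ∧ Y j k = 0 ∧ Y j l = 0 then (1 : ℝ) else 0)
      ≤ rectCount Y := by
  have h := Finset.sum_le_sum fun i (_ : i ∈ Finset.univ) =>
    Finset.sum_le_sum fun j (_ : j ∈ Finset.univ) =>
    Finset.sum_le_sum fun k (_ : k ∈ Finset.univ) =>
    Finset.sum_le_sum fun l (_ : l ∈ Finset.univ) => sum_corner_indicators_le
      (Y i k) (Y i l) (Y j k) (Y j l) (i ∈ H) (j ∈ H) (k ∈ K) (l ∈ K)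
  have swap₁ : ∀ F : Fin n → Fin n → Fin n → Fin n → ℝ,
      ∑ i, ∑ j, ∑ k, ∑ l, F j i k l = ∑ i, ∑ j, ∑ k, ∑ l, F i j k l :=
    fun F => Finset.sum_comm
  have swap₂ : ∀ F : Fin n → Fin n → Fin n → Fin n → ℝ,
      ∑ i, ∑ j, ∑ k, ∑ l, F i j l k = ∑ i, ∑ j, ∑ k, ∑ l, F i j k l :=
    fun F => Finset.sum_congr rfl fun i _ => Finset.sum_congr rfl fun j _ => Finset.sum_comm
  simp only [Finset.sum_add_distrib] at h
  refine le_trans (le_of_eq ?_) h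
  rw [swap₁ (fun i j k l => if i ∈ H ∧ Y i k ≠ Y i l ∧ Y j k = 0 ∧ Y j l = 0 then (1 : ℝ) else 0),
    swap₂ (fun i j k l =>
      if k ∈ K ∧ i ∉ H ∧ j ∉ H ∧ Y i k ≠ Y j k ∧ Y i l = 0 ∧ Y j l = 0 then (1 : ℝ) else 0),
    swap₂ (fun i j k l =>
      if i ∉ H ∧ k ∉ K ∧ Y i k ≠ 0 ∧ Y i l = 0 ∧ Y j k = 0 ∧ Y j l = 0 then (1 : ℝ) else 0),
    swap₁ (fun i j k l =>
      if i ∉ H ∧ k ∉ K ∧ Y i k ≠ 0 ∧ Y i l = 0 ∧ Y j k = 0 ∧ Y j l = 0 then (1 : ℝ) else 0),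
    swap₂ (fun i j k l =>
      if j ∉ H ∧ k ∉ K ∧ Y j k ≠ 0 ∧ Y j l = 0 ∧ Y i k = 0 ∧ Y i l = 0 then (1 : ℝ) else 0),
    swap₁ (fun i j k l =>
      if i ∉ H ∧ k ∉ K ∧ Y i k ≠ 0 ∧ Y i l = 0 ∧ Y j k = 0 ∧ Y j l = 0 then (1 : ℝ) else 0)]
  ring

theorem IsMinimal.le_sum_heavy_rows (hY : IsMinimal Y) (H : Finset (Fin n)) :
    ∑ i ∈ H, ((n : ℝ) ^ 2 * ∑ l, (if Y i l = 0 then (0 : ℝ) else 1) - 2 * n * weight Y) ≤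
      ∑ i, ∑ j, ∑ k, ∑ l,
        if i ∈ H ∧ Y i k ≠ Y i l ∧ Y j k = 0 ∧ Y j l = 0 then (1 : ℝ) else 0 := by
  rw [← Finset.sum_filter_add_sum_filter_not Finset.univ (· ∈ H)]
  rw [Finset.filter_univ_mem]
  refine le_add_of_le_of_nonneg (Finset.sum_le_sum fun i hi => ?_)
    (Finset.sum_nonneg fun i _ => Finset.sum_nonneg fun j _ => Finset.sum_nonneg fun k _ =>
      Finset.sum_nonneg fun l _ => by split_ifs <;> norm_num)
  calc _ ≤ ∑ j, ∑ k, ∑ l, ((if Y i k = Y i l then (0 : ℝ) else 1)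
        - (if Y j k = 0 then 0 else 1) - (if Y j l = 0 then 0 else 1)) := by
        have h := mul_le_mul_of_nonneg_left (hY.row_pairs i) (Nat.cast_nonneg (α := ℝ) n)
        simp only [Finset.sum_sub_distrib, Finset.sum_const, Finset.card_univ, Fintype.card_fin,
          nsmul_eq_mul, ← Finset.mul_sum]
        unfold weight
        linarith
    _ ≤ _ := Finset.sum_le_sum fun j _ => Finset.sum_le_sum fun k _ =>
        Finset.sum_le_sum fun l _ => by
          by_cases h₁ : Y i k = Y i l <;> by_cases h₂ : Y j k = 0 <;> by_cases h₃ : Y j l = 0 <;>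
            simp [hi, h₁, h₂, h₃]

theorem IsMinimal.le_sum_heavy_cols (hY : IsMinimal Y) (H K : Finset (Fin n)) :
    ∑ k ∈ K, ((n : ℝ) ^ 2 * ∑ i, (if Y i k = 0 then (0 : ℝ) else 1) - 2 * n * weight Y
        - 2 * n ^ 2 * H.card) ≤
      ∑ i, ∑ j, ∑ k, ∑ l,
        if k ∈ K ∧ i ∉ H ∧ j ∉ H ∧ Y i k ≠ Y j k ∧ Y i l = 0 ∧ Y j l = 0 then (1 : ℝ) else 0 := by
  have hsum : ∀ F : Fin n → Fin n → Fin n → ℝ,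
      ∑ i, ∑ j, ∑ k, F i j k = ∑ k, ∑ i, ∑ j, F i j k := fun F => by
    rw [Finset.sum_comm]
    simp_rw [fun j => Finset.sum_comm (s := Finset.univ (α := Fin n)) (t := Finset.univ)
      (f := fun i k => F i j k)]
    rw [Finset.sum_comm]
    exact Finset.sum_congr rfl fun k _ => Finset.sum_comm
  rw [hsum, ← Finset.sum_filter_add_sum_filter_not Finset.univ (· ∈ K), Finset.filter_univ_mem]
  refine le_add_of_le_of_nonneg (Finset.sum_le_sum fun k hk => ?_)
    (Finset.sum_nonneg fun i _ => Finset.sum_nonneg fun j _ => Finset.sum_nonneg fun k _ =>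
      Finset.sum_nonneg fun l _ => by split_ifs <;> norm_num)
  calc _ ≤ ∑ i, ∑ j, ∑ l, ((if Y i k = Y j k then (0 : ℝ) else 1)
        - (if Y i l = 0 then 0 else 1) - (if Y j l = 0 then 0 else 1)
        - (if i ∈ H then 1 else 0) - (if j ∈ H then 1 else 0)) := by
        have h := mul_le_mul_of_nonneg_left (hY.col_pairs k) (Nat.cast_nonneg (α := ℝ) n)
        simp only [Finset.sum_sub_distrib, Finset.sum_const, Finset.card_univ, Fintype.card_fin,
          nsmul_eq_mul, ← Finset.mul_sum, Finset.sum_boole, Finset.filter_univ_mem]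
        unfold weight
        linarith
    _ ≤ _ := Finset.sum_le_sum fun i _ => Finset.sum_le_sum fun j _ =>
        Finset.sum_le_sum fun l _ => by
          by_cases h₁ : Y i k = Y j k <;> by_cases h₂ : Y i l = 0 <;> by_cases h₃ : Y j l = 0 <;>
            by_cases h₄ : i ∈ H <;> by_cases h₅ : j ∈ H <;> simp [hk, h₁, h₂, h₃, h₄, h₅] <;>
            norm_num

theorem le_sum_light_cells (H K : Finset (Fin n)) :
    ∑ i, ∑ k, (if i ∉ H ∧ k ∉ K ∧ Y i k ≠ 0 then ((n : ℝ) ^ 2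
        - n * ∑ l, (if Y i l = 0 then (0 : ℝ) else 1)
        - n * ∑ j, (if Y j k = 0 then (0 : ℝ) else 1) - weight Y) else 0) ≤
      ∑ i, ∑ j, ∑ k, ∑ l,
        if i ∉ H ∧ k ∉ K ∧ Y i k ≠ 0 ∧ Y i l = 0 ∧ Y j k = 0 ∧ Y j l = 0 then (1 : ℝ) else 0 := by
  refine Finset.sum_le_sum fun i _ => ?_
  rw [Finset.sum_comm]
  refine Finset.sum_le_sum fun k _ => ?_
  split_ifs with h
  · obtain ⟨hi, hk, hik⟩ := h
    calc _ = ∑ j, ∑ l, (1 - (if Y i l = 0 then (0 : ℝ) else 1)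
          - (if Y j k = 0 then 0 else 1) - (if Y j l = 0 then 0 else 1)) := by
          simp only [Finset.sum_sub_distrib, Finset.sum_const, Finset.card_univ, Fintype.card_fin,
            nsmul_eq_mul, ← Finset.mul_sum]
          unfold weight
          ring
      _ ≤ _ := Finset.sum_le_sum fun j _ => Finset.sum_le_sum fun l _ => by
          by_cases h₁ : Y i l = 0 <;> by_cases h₂ : Y j k = 0 <;> by_cases h₃ : Y j l = 0 <;>
            simp [hi, hk, hik, h₁, h₂, h₃]
  · exact Finset.sum_nonneg fun j _ => Finset.sum_nonneg fun l _ => by split_ifs <;> norm_num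

theorem weight_nonneg : 0 ≤ weight Y :=
  Finset.sum_nonneg fun i _ => Finset.sum_nonneg fun k _ => by split_ifs <;> norm_num

theorem row_weight_le (i : Fin n) : ∑ k, (if Y i k = 0 then (0 : ℝ) else 1) ≤ weight Y :=
  Finset.single_le_sum (f := fun i => ∑ k, (if Y i k = 0 then (0 : ℝ) else 1))
    (fun i _ => Finset.sum_nonneg fun k _ => by split_ifs <;> norm_num) (Finset.mem_univ i)

theorem weight_transpose : weight Y.transpose = weight Y := Finset.sum_comm

theorem col_weight_le (k : Fin n) : ∑ i, (if Y i k = 0 then (0 : ℝ) else 1) ≤ weight Y :=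
  (row_weight_le (Y := Y.transpose) k).trans_eq weight_transpose

theorem four_mul_weight_le_rectCount :
    4 * weight Y * (n ^ 2 - 2 * n * weight Y - weight Y) ≤ rectCount Y := by
  refine le_trans ?_ (two_mul_sum_le_rectCount ∅ ∅)
  refine le_trans ?_ (add_le_add_right (mul_le_mul_of_nonneg_left
    (le_sum_light_cells (Y := Y) ∅ ∅) (by norm_num)) _)
  simp only [Finset.notMem_empty, false_and, not_false_eq_true, true_and, if_false,
    Finset.sum_const_zero, mul_zero, zero_add, add_zero]
  rw [mul_assoc]
  refine mul_le_mul_of_nonneg_left ?_ (by norm_num)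
  conv_lhs => rw [weight, Finset.sum_mul]
  refine Finset.sum_le_sum fun i _ => ?_
  rw [Finset.sum_mul]
  refine Finset.sum_le_sum fun k _ => ?_
  by_cases h : Y i k = 0
  · simp [h]
  · simp only [h, if_false, one_mul, not_false_eq_true, if_true, ne_eq]
    have h₁ := mul_le_mul_of_nonneg_left (row_weight_le (Y := Y) i) (Nat.cast_nonneg (α := ℝ) n)
    have h₂ := mul_le_mul_of_nonneg_left (col_weight_le (Y := Y) k) (Nat.cast_nonneg (α := ℝ) n)
    change _ ≤ (n : ℝ) ^ 2 - n * ∑ l, (if Y i l = 0 then (0 : ℝ) else 1)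
        - n * ∑ j, (if Y j k = 0 then (0 : ℝ) else 1) - weight Y
    unfold weight at h₁ h₂ ⊢
    linarith

theorem weight_le_heavy_add_light (H K : Finset (Fin n)) :
    weight Y ≤ (∑ i ∈ H, ∑ l, (if Y i l = 0 then (0 : ℝ) else 1))
      + (∑ k ∈ K, ∑ i, (if Y i k = 0 then (0 : ℝ) else 1))
      + ∑ i, ∑ k, (if i ∉ H ∧ k ∉ K ∧ Y i k ≠ 0 then (1 : ℝ) else 0) := by
  have h₁ : (∑ i ∈ H, ∑ l, (if Y i l = 0 then (0 : ℝ) else 1)) =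
      ∑ i, ∑ l, (if i ∈ H ∧ Y i l ≠ 0 then (1 : ℝ) else 0) := by
    rw [← Finset.filter_univ_mem H, Finset.sum_filter]
    refine Finset.sum_congr rfl fun i _ => ?_
    by_cases hi : i ∈ H <;> simp [hi]
  have h₂ : (∑ k ∈ K, ∑ i, (if Y i k = 0 then (0 : ℝ) else 1)) =
      ∑ i, ∑ k, (if k ∈ K ∧ Y i k ≠ 0 then (1 : ℝ) else 0) := by
    rw [Finset.sum_comm (s := Finset.univ), ← Finset.filter_univ_mem K, Finset.sum_filter]
    refine Finset.sum_congr rfl fun i _ => ?_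
    by_cases hi : i ∈ K <;> simp [hi]
  rw [h₁, h₂]
  simp only [← Finset.sum_add_distrib]
  refine Finset.sum_le_sum fun i _ => Finset.sum_le_sum fun k _ => ?_
  by_cases hz : Y i k = 0 <;> by_cases hi : i ∈ H <;> by_cases hk : k ∈ K <;>
    simp [hz, hi, hk]

theorem IsMinimal.two_mul_weight_le_rectCount (hY : IsMinimal Y) :
    2 * weight Y * (n ^ 2 - 144 * weight Y) ≤ rectCount Y := by
  have hw := weight_nonneg (Y := Y)
  have hn : (0 : ℝ) ≤ n := Nat.cast_nonneg n
  rcases le_total ((n : ℝ) ^ 2 - 144 * weight Y) 0 with hneg | hpos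
  · exact (mul_nonpos_of_nonneg_of_nonpos (by positivity) hneg).trans
      (Finset.sum_nonneg fun i _ => Finset.sum_nonneg fun k _ => Finset.sum_nonneg fun j _ =>
        Finset.sum_nonneg fun l _ => by split_ifs <;> norm_num)
  classical
  set H : Finset (Fin n) := Finset.univ.filter fun i =>
    (n : ℝ) < 8 * ∑ l, (if Y i l = 0 then (0 : ℝ) else 1) with hH
  set K : Finset (Fin n) := Finset.univ.filter fun k =>
    (n : ℝ) < 8 * ∑ i, (if Y i k = 0 then (0 : ℝ) else 1) with hK
  have hHmem : ∀ i, i ∈ H ↔ (n : ℝ) < 8 * ∑ l, (if Y i l = 0 then (0 : ℝ) else 1) := by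
    simp [hH]
  have hKmem : ∀ k, k ∈ K ↔ (n : ℝ) < 8 * ∑ i, (if Y i k = 0 then (0 : ℝ) else 1) := by
    simp [hK]
  have hcard : (n : ℝ) * H.card ≤ 8 * weight Y := by
    calc (n : ℝ) * H.card = ∑ _i ∈ H, (n : ℝ) := by simp [mul_comm]
      _ ≤ ∑ i ∈ H, 8 * ∑ l, (if Y i l = 0 then (0 : ℝ) else 1) :=
          Finset.sum_le_sum fun i hi => ((hHmem i).1 hi).le
      _ = 8 * ∑ i ∈ H, ∑ l, (if Y i l = 0 then (0 : ℝ) else 1) := by rw [Finset.mul_sum]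
      _ ≤ 8 * weight Y := by
          refine mul_le_mul_of_nonneg_left ?_ (by norm_num)
          exact Finset.sum_le_sum_of_subset_of_nonneg (Finset.subset_univ _) fun i _ _ =>
            Finset.sum_nonneg fun k _ => by split_ifs <;> norm_num
  have h₁ := hY.le_sum_heavy_rows H
  have h₂ := hY.le_sum_heavy_cols H K
  have h₃ := le_sum_light_cells (Y := Y) H K
  have h₁' : (n ^ 2 - 144 * weight Y) * ∑ i ∈ H, ∑ l, (if Y i l = 0 then (0 : ℝ) else 1) ≤
      ∑ i ∈ H, ((n : ℝ) ^ 2 * ∑ l, (if Y i l = 0 then (0 : ℝ) else 1) - 2 * n * weight Y) := by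
    rw [Finset.mul_sum]
    refine Finset.sum_le_sum fun i hi => ?_
    have := (hHmem i).1 hi
    nlinarith
  have h₂' : (n ^ 2 - 144 * weight Y) * ∑ k ∈ K, ∑ i, (if Y i k = 0 then (0 : ℝ) else 1) ≤
      ∑ k ∈ K, ((n : ℝ) ^ 2 * ∑ i, (if Y i k = 0 then (0 : ℝ) else 1) - 2 * n * weight Y
        - 2 * n ^ 2 * H.card) := by
    rw [Finset.mul_sum]
    refine Finset.sum_le_sum fun k hk => ?_
    have h₄ := (hKmem k).1 hk
    have h₅ := mul_le_mul_of_nonneg_left hcard hn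
    have h₆ := mul_le_mul_of_nonneg_right h₄.le hw
    linarith
  have h₃' : (n ^ 2 - 144 * weight Y) *
        ∑ i, ∑ k, (if i ∉ H ∧ k ∉ K ∧ Y i k ≠ 0 then (1 : ℝ) else 0) ≤
      2 * ∑ i, ∑ k, (if i ∉ H ∧ k ∉ K ∧ Y i k ≠ 0 then ((n : ℝ) ^ 2
        - n * ∑ l, (if Y i l = 0 then (0 : ℝ) else 1)
        - n * ∑ j, (if Y j k = 0 then (0 : ℝ) else 1) - weight Y) else 0) := by
    simp only [Finset.mul_sum]
    refine Finset.sum_le_sum fun i _ => Finset.sum_le_sum fun k _ => ?_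
    split_ifs with h
    · have h₄ := not_lt.1 (mt (hHmem i).2 h.1)
      have h₅ := not_lt.1 (mt (hKmem k).2 h.2.1)
      simp only [← Finset.mul_sum]
      nlinarith
    · simp
  have h₄ := mul_le_mul_of_nonneg_left (weight_le_heavy_add_light (Y := Y) H K) hpos
  have h₅ := two_mul_sum_le_rectCount (Y := Y) H K
  linarith

end Combinatorics

section Estimates

open Real

theorem two_mul_log_le_of_density_bounds {n m a : ℝ} (hn : 4 ≤ n) (hm : 1 ≤ m) (ha : 1 ≤ a)
    (ha₁ : 4 * (1 - 2 * m / n - m / n ^ 2) ≤ a) (ha₂ : 2 * (1 - 144 * m / n ^ 2) ≤ a) :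
    2 * log n ≤ a / 2 * log n + log m + 100 * √(log n) := by
  have hℓ : 1 ≤ log n := by
    rw [le_log_iff_exp_le (by linarith)]
    have := exp_one_lt_d9
    linarith
  have hs : √(log n) ^ 2 = log n := sq_sqrt (by linarith)
  have hs1 : 1 ≤ √(log n) := one_le_sqrt.2 hℓ
  have hlogm : 0 ≤ log m := log_nonneg hm
  have hloglog : log (log n) ≤ 2 * √(log n) := by
    have := log_le_sub_one_of_pos (x := √(log n)) (by linarith)
    have h2 : log (log n) = 2 * log (√(log n)) := by
      rw [← hs, log_pow, hs]; norm_num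
    linarith
  set s := √(log n) with hsdef
  have hnpos : 0 < n := by linarith
  have hmpos : 0 < m := by linarith
  rcases le_total s 66 with h66 | h66
  · nlinarith
  have haℓ : ∀ b, b ≤ a → b * log n ≤ a * log n := fun b hb =>
    mul_le_mul_of_nonneg_right hb (by linarith)
  rcases le_total (8 * m) n with hmn | hmn
  · have hsq : m / n ^ 2 ≤ m / n := by
      apply div_le_div_of_nonneg_left hmpos.le hnpos
      nlinarith
    have h := haℓ (4 - 12 * (m / n)) (by
      rw [mul_div_assoc] at ha₁
      linarith)
    rcases le_total n (m * log n) with hy | hy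
    · have h₁ : m / n ≤ 1 / 8 := by
        rw [div_le_div_iff₀ hnpos (by norm_num)]; linarith
      have h₂ : log n ≤ log m + log (log n) := by
        rw [← log_mul (by positivity) (by positivity)]
        exact log_le_log hnpos hy
      have h₃ := mul_le_mul_of_nonneg_right h₁ (by linarith : 0 ≤ log n)
      linarith
    · have h₁ : m / n * log n ≤ 1 := by
        rw [div_mul_eq_mul_div, div_le_one hnpos]; exact hy
      linarith
  · rcases le_total (m * log n) (n ^ 2) with hy | hy
    · have h := haℓ (2 - 288 * (m / n ^ 2)) (by
        rw [mul_div_assoc] at ha₂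
        linarith)
      have h₁ : m / n ^ 2 * log n ≤ 1 := by
        rw [div_mul_eq_mul_div, div_le_one (by positivity)]; exact hy
      have h₂ : log n ≤ log 8 + log m := by
        rw [← log_mul (by norm_num) (by positivity)]
        exact log_le_log hnpos hmn
      have h₃ := log_le_sub_one_of_pos (x := 8) (by norm_num)
      linarith
    · have h₂ : log (n ^ 2) ≤ log m + log (log n) := by
        rw [← log_mul (by positivity) (by positivity)]
        exact log_le_log (by positivity) hy
      rw [log_pow] at h₂
      push_cast at h₂
      have := haℓ 1 ha
      linarith

theorem one_le_loglog_sixteen_mul {n : ℝ} (hn : 4 ≤ n) : 1 ≤ log (log (16 * n)) := by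
  have h : exp 1 ≤ log (16 * n) := by
    rw [le_log_iff_exp_le (by linarith)]
    have h₁ : exp 1 ≤ 2.75 := by have := exp_one_lt_d9; linarith
    have h₂ : exp (exp 1) ≤ exp 3 := exp_le_exp.2 (by linarith)
    have h₃ : exp 3 = exp 1 ^ 3 := by rw [← exp_nat_mul]; norm_num
    have h₄ : exp 1 ^ 3 ≤ 2.75 ^ 3 := by gcongr
    norm_num at h₄
    linarith
  rwa [le_log_iff_exp_le (by linarith [exp_pos 1])]

theorem seven_sixths_le_sqrt_log {n : ℝ} (hn : 4 ≤ n) : 7 / 6 ≤ √(log n) := by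
  apply le_sqrt_of_sq_le
  have h₁ : log 4 ≤ log n := log_le_log (by norm_num) hn
  have h₂ : log 4 = 2 * log 2 := by
    rw [show (4 : ℝ) = 2 ^ 2 by norm_num, log_pow]; norm_num
  have := log_two_gt_d9
  linarith

/-- The time bound makes each Fourier coefficient beat the number of characters of its weight. -/
theorem entropy_le_exponent {n q m C κ t T : ℝ} (hn : 4 ≤ n) (hq : 2 ≤ q) (hm : 1 ≤ m)
    (hC : 640 / log (log (16 * n)) ≤ C) (hκ : 0 < κ)
    (ht : n ^ 2 / (4 * κ) * log n + n ^ 2 / κ * C * log (log (16 * n)) * √(log n) * log q ≤ t)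
    (hT₀ : n ^ 2 * m ≤ T) (hT₁ : 4 * m * (n ^ 2 - 2 * n * m - m) ≤ T)
    (hT₂ : 2 * m * (n ^ 2 - 144 * m) ≤ T) :
    m * (1 + log (n ^ 2 * q / m) + log 2) + 2 * C * log q ≤ 2 * t * (κ * T / n ^ 4) := by
  have hL := one_le_loglog_sixteen_mul hn
  have hs := seven_sixths_le_sqrt_log hn
  have hnpos : 0 < n := by linarith
  have hmpos : 0 < m := by linarith
  have hℓ : 0 ≤ log n := log_nonneg (by linarith)
  have hlq : 0.69 ≤ log q := by
    have := log_two_gt_d9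
    have := log_le_log (by norm_num) hq
    linarith
  set L := log (log (16 * n))
  rw [div_le_iff₀ (by linarith)] at hC
  have hCpos : 0 ≤ C := by
    by_contra h
    nlinarith
  obtain ⟨a, rfl⟩ : ∃ a, T = n ^ 2 * m * a := ⟨T / (n ^ 2 * m), by field_simp⟩
  have ha : 1 ≤ a := by
    have : 0 < n ^ 2 * m := by positivity
    by_contra h
    nlinarith
  have core := two_mul_log_le_of_density_bounds hn hm ha
    (by
      refine le_of_mul_le_mul_left (le_trans (le_of_eq ?_) hT₁) (by positivity : 0 < n ^ 2 * m)
      field_simp)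
    (by
      refine le_of_mul_le_mul_left (le_trans (le_of_eq ?_) hT₂) (by positivity : 0 < n ^ 2 * m)
      field_simp)
  have hlog : log (n ^ 2 * q / m) = 2 * log n + log q - log m := by
    rw [log_div (by positivity) hmpos.ne', log_mul (by positivity) (by positivity), log_pow]
    norm_num
  set s := √(log n)
  have htime : a * m * (log n / 2 + 2 * (C * L * s * log q)) ≤
      2 * t * (κ * (n ^ 2 * m * a) / n ^ 4) := by
    have h := mul_le_mul_of_nonneg_left ht
      (by positivity : 0 ≤ 2 * (κ * (n ^ 2 * m * a) / n ^ 4))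
    refine le_trans (le_of_eq ?_) (h.trans_eq (by ring))
    field_simp
    ring
  refine le_trans ?_ htime
  rw [hlog]
  have hQ₁ : 640 * s * log q ≤ C * L * s * log q := by gcongr
  have hQ₂ : 7 / 6 * (C * log q) ≤ C * L * s * log q := by
    have : C * 1 * (7 / 6) * log q ≤ C * L * s * log q := by gcongr
    linarith
  set Q := C * L * s * log q
  have hsq : 0.69 * s ≤ s * log q := by nlinarith
  have hqs : 7 / 6 * log q ≤ s * log q := by gcongr
  have hlog2 := log_two_lt_d9
  have hmain : 1 + log q + log 2 + 100 * s + 2 * C * log q ≤ 2 * Q := by linarith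
  have hQ : 0 ≤ Q := by positivity
  have h₁ := mul_le_mul_of_nonneg_left core hmpos.le
  have h₂ := mul_le_mul_of_nonneg_left hmain hmpos.le
  have h₃ : 2 * C * log q ≤ m * (2 * C * log q) := le_mul_of_one_le_left (by positivity) hm
  have h₄ : m * (2 * Q) ≤ a * (m * (2 * Q)) := le_mul_of_one_le_left (by positivity) ha
  linarith

theorem full_entropy_le_time {n q C κ t : ℝ} (hn : 4 ≤ n) (hq : 2 ≤ q)
    (hC : 640 / log (log (16 * n)) ≤ C) (hκ : 0 < κ) (hκ₂ : κ ≤ 2)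
    (ht : n ^ 2 / (4 * κ) * log n + n ^ 2 / κ * C * log (log (16 * n)) * √(log n) * log q ≤ t) :
    n ^ 2 * log q + 2 * C * log q ≤ 2 * t := by
  have hL := one_le_loglog_sixteen_mul hn
  have hs := seven_sixths_le_sqrt_log hn
  have hnpos : 0 < n := by linarith
  have hℓ : 0 ≤ log n := log_nonneg (by linarith)
  have hlq : 0 ≤ log q := log_nonneg (by linarith)
  set L := log (log (16 * n))
  rw [div_le_iff₀ (by linarith)] at hC
  have hCpos : 0 ≤ C := by
    by_contra h
    nlinarith
  set s := √(log n)
  have hQ₁ : 640 * 1 * log q ≤ C * L * s * log q := by gcongr; linarith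
  have hQ₂ : C * 1 * 1 * log q ≤ C * L * s * log q := by gcongr; linarith
  set Q := C * L * s * log q with hQdef
  have hQ : 0 ≤ Q := by positivity
  have h₁ : n ^ 2 / 2 * Q ≤ t := by
    have : n ^ 2 / 2 ≤ n ^ 2 / κ := by gcongr
    have h₂ := mul_le_mul_of_nonneg_right this hQ
    have h₃ : 0 ≤ n ^ 2 / (4 * κ) * log n := by positivity
    have h₄ : n ^ 2 / κ * Q = n ^ 2 / κ * C * L * s * log q := by rw [hQdef]; ring
    linarith
  have h₂ := mul_le_mul_of_nonneg_left hQ₁ (sq_nonneg n)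
  have h₃ : 16 * Q ≤ n ^ 2 * Q := mul_le_mul_of_nonneg_right (by nlinarith) hQ
  have h₄ : 0 ≤ n ^ 2 * log q := by positivity
  linarith

end Estimates

section Fourier

open ZMod

variable {n q : ℕ}

/-- The standard bilinear pairing of matrices. -/
def pairing (Y z : Matrix (Fin n) (Fin n) (ZMod q)) : ZMod q := ∑ i, ∑ k, Y i k * z i k

theorem pairing_add_right (Y z w : Matrix (Fin n) (Fin n) (ZMod q)) :
    pairing Y (z + w) = pairing Y z + pairing Y w := by
  simp [pairing, mul_add, Finset.sum_add_distrib]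

theorem pairing_add_left (Y Z w : Matrix (Fin n) (Fin n) (ZMod q)) :
    pairing (Y + Z) w = pairing Y w + pairing Z w := by
  simp [pairing, add_mul, Finset.sum_add_distrib]

theorem pairing_neg_right (Y z : Matrix (Fin n) (Fin n) (ZMod q)) :
    pairing Y (-z) = -pairing Y z := by
  simp [pairing]

theorem pairing_sub_right (Y z w : Matrix (Fin n) (Fin n) (ZMod q)) :
    pairing Y (z - w) = pairing Y z - pairing Y w := by
  rw [sub_eq_add_neg, pairing_add_right, pairing_neg_right, sub_eq_add_neg]

theorem pairing_zero_left (z : Matrix (Fin n) (Fin n) (ZMod q)) : pairing 0 z = 0 := by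
  simp [pairing]

theorem pairing_DGmat (Y : Matrix (Fin n) (Fin n) (ZMod q)) (a b c d : Fin n) :
    pairing Y (DGmat n q (a + 1) (b + 1) (c + 1) (d + 1)) = rectSum Y a b c d := by
  simp only [pairing, DGmat, Matrix.of_apply, add_left_inj, Fin.val_inj, mul_add, mul_sub,
    Finset.sum_add_distrib, Finset.sum_sub_distrib, mul_ite, mul_one, mul_zero, ite_and, rectSum]
  simp

variable [NeZero q]

/-- The Fourier transform on matrices over `ZMod q`. -/
noncomputable def fourierTransform (h : Matrix (Fin n) (Fin n) (ZMod q) → ℝ)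
    (Y : Matrix (Fin n) (Fin n) (ZMod q)) : ℂ :=
  ∑ z, (h z : ℂ) * stdAddChar (pairing Y z)

theorem sum_stdAddChar_pairing (d : Matrix (Fin n) (Fin n) (ZMod q)) :
    ∑ Y : Matrix (Fin n) (Fin n) (ZMod q), stdAddChar (pairing Y d)
      = if d = 0 then ((q : ℂ) ^ (n ^ 2)) else 0 := by
  let ψ : AddChar (Matrix (Fin n) (Fin n) (ZMod q)) ℂ :=
    { toFun := fun Y => stdAddChar (pairing Y d)
      map_zero_eq_one' := by simp [pairing_zero_left]
      map_add_eq_mul' := fun Y Z => by rw [pairing_add_left, AddChar.map_add_eq_mul] }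
  split_ifs with hd
  · subst hd
    have : ∀ Y : Matrix (Fin n) (Fin n) (ZMod q), pairing Y 0 = 0 := by simp [pairing]
    simp only [this, AddChar.map_zero_eq_one, Finset.sum_const, Finset.card_univ, nsmul_eq_mul,
      mul_one]
    rw [show Fintype.card (Matrix (Fin n) (Fin n) (ZMod q)) =
      Fintype.card (Fin n → Fin n → ZMod q) from rfl]
    simp [← pow_mul, sq]
  · change ∑ Y, ψ Y = 0
    rw [AddChar.sum_eq_zero_iff_ne_zero]
    intro h0
    apply hd
    ext i k
    have h1 : ψ (Matrix.single i k 1) = 1 := by rw [h0]; rfl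
    have h2 : pairing (Matrix.single i k 1) d = d i k := by
      unfold pairing
      rw [Finset.sum_eq_single i, Finset.sum_eq_single k]
      · simp
      · intro b _ hb; simp [hb.symm]
      · simp
      · intro b _ hb
        exact Finset.sum_eq_zero fun c _ => by simp [hb.symm]
      · simp
    change stdAddChar (pairing _ d) = 1 at h1
    rw [h2, ← AddChar.map_zero_eq_one (stdAddChar (N := q))] at h1
    exact injective_stdAddChar h1

theorem conj_stdAddChar (a : ZMod q) :
    (starRingEnd ℂ) (stdAddChar a) = stdAddChar (-a) := by
  rw [stdAddChar_apply, stdAddChar_apply, ← Circle.coe_inv_eq_conj, AddChar.map_neg_eq_inv]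

theorem sum_norm_sq_fourierTransform (h : Matrix (Fin n) (Fin n) (ZMod q) → ℝ) :
    ∑ Y, ‖fourierTransform h Y‖ ^ 2 = (q : ℝ) ^ (n ^ 2) * ∑ z, h z ^ 2 := by
  have key : ∀ Y, ((‖fourierTransform h Y‖ ^ 2 : ℝ) : ℂ) =
      ∑ z, ∑ w, (h z : ℂ) * h w * stdAddChar (pairing Y (z - w)) := by
    intro Y
    rw [Complex.ofReal_pow, ← Complex.mul_conj', fourierTransform, map_sum, Finset.sum_mul_sum]
    refine Finset.sum_congr rfl fun z _ => Finset.sum_congr rfl fun w _ => ?_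
    rw [map_mul, conj_stdAddChar, Complex.conj_ofReal, pairing_sub_right, sub_eq_add_neg,
      AddChar.map_add_eq_mul]
    ring
  apply Complex.ofReal_injective
  rw [Complex.ofReal_sum]
  simp_rw [key]
  rw [Finset.sum_comm]
  push_cast
  rw [Finset.mul_sum]
  refine Finset.sum_congr rfl fun z _ => ?_
  rw [Finset.sum_comm]
  simp_rw [← Finset.mul_sum, sum_stdAddChar_pairing, sub_eq_zero]
  simp
  ring

theorem fourierTransform_convolution (f g : Matrix (Fin n) (Fin n) (ZMod q) → ℝ)
    (Y : Matrix (Fin n) (Fin n) (ZMod q)) :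
    fourierTransform (fun z => ∑ w, f w * g (z - w)) Y =
      fourierTransform f Y * fourierTransform g Y := by
  unfold fourierTransform
  push_cast
  simp_rw [Finset.sum_mul]
  rw [Finset.sum_comm]
  refine Finset.sum_congr rfl fun w _ => ?_
  rw [Finset.mul_sum, ← Equiv.sum_comp (Equiv.addRight w)]
  refine Finset.sum_congr rfl fun z _ => ?_
  simp only [Equiv.coe_addRight, add_sub_cancel_right, pairing_add_right, AddChar.map_add_eq_mul]
  ring

theorem sum_eq_two_mul_sum_lt (f : Fin n → Fin n → ℝ) (hs : ∀ a b, f a b = f b a)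
    (hd : ∀ a, f a a = 0) : ∑ a, ∑ b, f a b = 2 * ∑ a, ∑ b, if a < b then f a b else 0 := by
  have h : ∀ a b, f a b = (if a < b then f a b else 0) + if b < a then f b a else 0 := by
    intro a b
    rcases lt_trichotomy a b with h | rfl | h
    · simp [h, h.not_gt]
    · simp [hd]
    · simp [h, h.not_gt, hs a b]
  calc ∑ a, ∑ b, f a b
      = ∑ a, ∑ b, ((if a < b then f a b else 0) + if b < a then f b a else 0) :=
        Finset.sum_congr rfl fun a _ => Finset.sum_congr rfl fun b _ => h a b
    _ = _ := by
        simp_rw [Finset.sum_add_distrib]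
        rw [two_mul, Finset.sum_comm (f := fun a b => if b < a then f b a else 0)]

theorem sum_Icc_one_eq (F : ℕ → ℂ) : ∑ i ∈ Finset.Icc 1 n, F i = ∑ a : Fin n, F (a + 1) := by
  rw [Fin.sum_univ_eq_sum_range (fun a => F (a + 1)) n, Finset.range_eq_Ico,
    Finset.sum_Ico_add' F 0 n 1]
  rfl

/-- The total deviation of the rectangle characters from `1`. -/
noncomputable def rectDefect (Y : Matrix (Fin n) (Fin n) (ZMod q)) : ℝ :=
  ∑ i, ∑ j, ∑ k, ∑ l, (1 - (stdAddChar (rectSum Y i j k l)).re)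

theorem re_stdAddChar_neg (a : ZMod q) : (stdAddChar (-a)).re = (stdAddChar a).re := by
  rw [← conj_stdAddChar, Complex.conj_re]

theorem rectDefect_eq_four_mul (Y : Matrix (Fin n) (Fin n) (ZMod q)) :
    rectDefect Y = 4 * ∑ i, ∑ j, ∑ k, ∑ l,
      if i < j ∧ k < l then (1 - (stdAddChar (rectSum Y i j k l)).re) else 0 := by
  have h₁ : ∀ i j, ∑ k, ∑ l, (1 - (stdAddChar (rectSum Y i j k l)).re) =
      2 * ∑ k, ∑ l, if k < l then (1 - (stdAddChar (rectSum Y i j k l)).re) else 0 := by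
    intro i j
    refine sum_eq_two_mul_sum_lt _ (fun k l => ?_) fun k => ?_
    · rw [← re_stdAddChar_neg]
      congr 3
      simp [rectSum]; ring
    · simp [rectSum]
  unfold rectDefect
  rw [sum_eq_two_mul_sum_lt]
  · simp_rw [h₁]
    simp only [Finset.mul_sum]
    refine Finset.sum_congr rfl fun i _ => Finset.sum_congr rfl fun j _ => ?_
    split_ifs with h
    · simp only [Finset.mul_sum, h, true_and]
      refine Finset.sum_congr rfl fun k _ => Finset.sum_congr rfl fun l _ => ?_
      ring
    · simp [h]
  · intro i j
    refine Finset.sum_congr rfl fun k _ => Finset.sum_congr rfl fun l _ => ?_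
    rw [← re_stdAddChar_neg]
    congr 3
    simp [rectSum]; ring
  · intro i
    refine Finset.sum_eq_zero fun k _ => Finset.sum_eq_zero fun l _ => ?_
    simp [rectSum]

theorem sum_lt_eq_choose : (∑ a : Fin n, ∑ b : Fin n, if a < b then (1 : ℝ) else 0) =
    n.choose 2 := by
  have h := sum_eq_two_mul_sum_lt (n := n) (fun a b => if a = b then 0 else 1)
    (fun a b => by simp [eq_comm]) (fun a => by simp)
  have h₁ : ∀ a : Fin n, (∑ b : Fin n, if a = b then (0 : ℝ) else 1) = n - 1 := by
    intro a
    have : ∀ b : Fin n, (if a = b then (0 : ℝ) else 1) = 1 - if a = b then 1 else 0 := fun b => by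
      split_ifs <;> norm_num
    simp [this]
  have h₂ : ∀ a b : Fin n, (if a < b then (if a = b then (0 : ℝ) else 1) else 0)
      = if a < b then 1 else 0 := by
    intro a b
    by_cases hab : a < b
    · simp [hab, hab.ne]
    · simp [hab]
  simp_rw [h₁, h₂] at h
  rw [Nat.cast_choose_two]
  simp only [Finset.sum_const, Finset.card_univ, Fintype.card_fin, nsmul_eq_mul] at h
  linarith

theorem fourierTransform_stepPMF (hn : 2 ≤ n) (Y : Matrix (Fin n) (Fin n) (ZMod q)) :
    fourierTransform (stepPMF n q) Y =
      ((1 - rectDefect Y / ((n : ℝ) ^ 2 * ((n : ℝ) - 1) ^ 2) : ℝ) : ℂ) := by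
  have hchoose : (0 : ℝ) < n.choose 2 := by exact_mod_cast Nat.choose_pos hn
  have hsum : fourierTransform (stepPMF n q) Y = (∑ a : Fin n, ∑ b : Fin n, ∑ c : Fin n, ∑ d : Fin n,
      if a < b ∧ c < d then 2 * ((stdAddChar (rectSum Y a b c d)).re : ℂ) else 0)
        / (2 * (n.choose 2 : ℂ) ^ 2) := by
    unfold fourierTransform stepPMF
    simp_rw [Finset.card_filter]
    push_cast
    simp_rw [div_mul_eq_mul_div, ← Finset.sum_div, Finset.sum_mul]
    congr 1
    rw [Finset.sum_comm]
    have hg : ∀ (P Q : Prop) [Decidable P] [Decidable Q] (φ : Matrix (Fin n) (Fin n) (ZMod q)),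
        ∑ g, ((if P ∧ Q ∧ φ = g then (1 : ℝ) else 0 : ℝ) : ℂ) * stdAddChar (pairing Y g) =
          if P ∧ Q then stdAddChar (pairing Y φ) else 0 := by
      intro P Q _ _ φ
      by_cases hP : P <;> by_cases hQ : Q <;> simp [hP, hQ, apply_ite Complex.ofReal]
    simp_rw [hg]
    simp_rw [Finset.sum_product, sum_Icc_one_eq]
    refine Finset.sum_congr rfl fun a _ => Finset.sum_congr rfl fun b _ =>
      Finset.sum_congr rfl fun c _ => Finset.sum_congr rfl fun d _ => ?_
    simp only [Fintype.sum_bool, if_true, Bool.false_eq_true, if_false, pairing_neg_right,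
      pairing_DGmat, add_lt_add_iff_right, Fin.val_fin_lt]
    split_ifs
    · rw [← conj_stdAddChar, Complex.add_conj]
      push_cast; rfl
    · simp
  rw [hsum]
  have hre : (∑ a : Fin n, ∑ b : Fin n, ∑ c : Fin n, ∑ d : Fin n,
      if a < b ∧ c < d then 2 * ((stdAddChar (rectSum Y a b c d)).re : ℂ) else 0) =
      ((2 * (n.choose 2 : ℝ) ^ 2 - rectDefect Y / 2 : ℝ) : ℂ) := by
    have h₁ : (n.choose 2 : ℝ) ^ 2 = ∑ a : Fin n, ∑ b : Fin n, ∑ c : Fin n, ∑ d : Fin n,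
        if a < b ∧ c < d then (1 : ℝ) else 0 := by
      rw [← sum_lt_eq_choose, sq, Finset.sum_mul]
      refine Finset.sum_congr rfl fun a _ => ?_
      rw [Finset.sum_mul]
      refine Finset.sum_congr rfl fun b _ => ?_
      by_cases h : a < b <;> simp [h]
    rw [rectDefect_eq_four_mul, h₁]
    push_cast
    simp only [Finset.mul_sum, Finset.sum_div, ← Finset.sum_sub_distrib]
    refine Finset.sum_congr rfl fun a _ => Finset.sum_congr rfl fun b _ =>
      Finset.sum_congr rfl fun c _ => Finset.sum_congr rfl fun d _ => ?_
    by_cases h : a < b ∧ c < d <;> simp [h]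
    ring
  rw [hre]
  have h4 : (n : ℝ) ^ 2 * ((n : ℝ) - 1) ^ 2 = 4 * (n.choose 2 : ℝ) ^ 2 := by
    rw [Nat.cast_choose_two]; ring
  rw [h4]
  norm_cast
  field_simp
  push_cast
  ring

theorem fourierTransform_walkDist (hn : 2 ≤ n) (x Y : Matrix (Fin n) (Fin n) (ZMod q)) (t : ℕ) :
    fourierTransform (walkDist n q x t) Y = stdAddChar (pairing Y x) *
      ((1 - rectDefect Y / ((n : ℝ) ^ 2 * ((n : ℝ) - 1) ^ 2) : ℝ) : ℂ) ^ t := by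
  induction t with
  | zero =>
    simp [fourierTransform, walkDist, apply_ite Complex.ofReal]
  | succ t ih =>
    rw [pow_succ, ← mul_assoc, ← ih, ← fourierTransform_stepPMF hn, ← fourierTransform_convolution]
    rfl

end Fourier

section SpectralBounds

open ZMod

variable {n q : ℕ}

theorem cos_two_pi_mul_div_le {v : ℕ} (hv : 0 < v) (hvq : v < q) :
    Real.cos (2 * Real.pi * (v / q)) ≤ Real.cos (2 * Real.pi / q) := by
  have hq : (0 : ℝ) < q := by exact_mod_cast hv.trans hvq
  have key : ∀ w : ℕ, 0 < w → 2 * w ≤ q →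
      Real.cos (2 * Real.pi * (w / q)) ≤ Real.cos (2 * Real.pi / q) := by
    intro w hw hwq
    have hw' : (1 : ℝ) ≤ w := by exact_mod_cast hw
    have hwq' : 2 * (w : ℝ) ≤ q := by exact_mod_cast hwq
    apply Real.cos_le_cos_of_nonneg_of_le_pi
    · positivity
    · rw [← mul_div_assoc, div_le_iff₀ hq]
      nlinarith [Real.pi_pos]
    · rw [← mul_div_assoc]
      exact div_le_div_of_nonneg_right (by nlinarith [Real.pi_pos]) hq.le
  rcases le_total (2 * v) q with h | h
  · exact key v hv h
  · have := key (q - v) (by omega) (by omega)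
    rw [Nat.cast_sub hvq.le] at this
    convert this using 1
    rw [← Real.cos_two_pi_sub]
    congr 1
    field_simp

theorem one_sub_cos_pos (hq : 2 ≤ q) : 0 < 1 - Real.cos (2 * Real.pi / q) := by
  have hq' : (2 : ℝ) ≤ q := by exact_mod_cast hq
  have h : Real.cos (2 * Real.pi / q) < Real.cos 0 := by
    apply Real.cos_lt_cos_of_nonneg_of_le_pi le_rfl
    · rw [div_le_iff₀ (by linarith)]
      nlinarith [Real.pi_pos]
    · have := Real.pi_pos
      positivity
  rw [Real.cos_zero] at h
  linarith

variable [NeZero q]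

theorem re_stdAddChar_le {a : ZMod q} (ha : a ≠ 0) :
    (stdAddChar a).re ≤ Real.cos (2 * Real.pi / q) := by
  rw [stdAddChar_apply, toCircle_eq_circleExp, Circle.coe_exp, Complex.exp_ofReal_mul_I_re]
  exact cos_two_pi_mul_div_le (Nat.pos_of_ne_zero (by simpa using ha)) (ZMod.val_lt a)

theorem re_stdAddChar_le_one (a : ZMod q) : (stdAddChar a).re ≤ 1 :=
  (Complex.re_le_norm _).trans (by rw [stdAddChar_apply, Circle.norm_coe])

theorem mul_rectCount_le_rectDefect (Y : Matrix (Fin n) (Fin n) (ZMod q)) :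
    (1 - Real.cos (2 * Real.pi / q)) * rectCount Y ≤ rectDefect Y := by
  unfold rectCount rectDefect
  simp only [Finset.mul_sum]
  refine Finset.sum_le_sum fun i _ => Finset.sum_le_sum fun j _ =>
    Finset.sum_le_sum fun k _ => Finset.sum_le_sum fun l _ => ?_
  split_ifs with h
  · simpa using re_stdAddChar_le_one (rectSum Y i j k l)
  · have := re_stdAddChar_le h
    linarith

theorem sum_one_sub_re_le (d : Fin n → ZMod q) :
    ∑ k, ∑ l, (1 - (stdAddChar (d k - d l)).re) ≤ (n : ℝ) ^ 2 := by
  have h : ∑ k, ∑ l, (stdAddChar (d k - d l)).re = ‖∑ k, stdAddChar (d k)‖ ^ 2 := by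
    apply Complex.ofReal_injective
    have h₁ : ((‖∑ k, stdAddChar (d k)‖ ^ 2 : ℝ) : ℂ) = ∑ k, ∑ l, stdAddChar (d k - d l) := by
      rw [Complex.ofReal_pow, ← Complex.mul_conj', map_sum, Finset.sum_mul_sum]
      refine Finset.sum_congr rfl fun k _ => Finset.sum_congr rfl fun l _ => ?_
      rw [conj_stdAddChar, sub_eq_add_neg, AddChar.map_add_eq_mul]
    have h₂ := congrArg Complex.re h₁
    rw [Complex.ofReal_re] at h₂
    rw [h₂]
    simp [Complex.re_sum]
  simp only [Finset.sum_sub_distrib, h]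
  simp only [Finset.sum_const, Finset.card_univ, Fintype.card_fin, nsmul_eq_mul, mul_one]
  nlinarith [sq_nonneg ‖∑ k, stdAddChar (d k)‖]

theorem rectDefect_le (Y : Matrix (Fin n) (Fin n) (ZMod q)) :
    rectDefect Y ≤ (n : ℝ) ^ 3 * (n - 1) := by
  have h : ∀ i j, ∑ k, ∑ l, (1 - (stdAddChar (rectSum Y i j k l)).re) ≤
      (n : ℝ) ^ 2 - if i = j then (n : ℝ) ^ 2 else 0 := by
    intro i j
    split_ifs with hij
    · subst hij
      simp [rectSum]
    · rw [sub_zero]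
      refine le_trans (le_of_eq ?_) (sum_one_sub_re_le fun k => Y i k - Y j k)
      refine Finset.sum_congr rfl fun k _ => Finset.sum_congr rfl fun l _ => ?_
      rw [rectSum, show Y i k + Y j l - Y i l - Y j k = Y i k - Y j k - (Y i l - Y j l) by ring]
  refine (Finset.sum_le_sum fun i _ => Finset.sum_le_sum fun j _ => h i j).trans (le_of_eq ?_)
  simp
  ring

theorem rectDefect_nonneg (Y : Matrix (Fin n) (Fin n) (ZMod q)) : 0 ≤ rectDefect Y :=
  Finset.sum_nonneg fun _ _ => Finset.sum_nonneg fun _ _ => Finset.sum_nonneg fun _ _ =>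
    Finset.sum_nonneg fun _ _ => sub_nonneg.2 (re_stdAddChar_le_one _)

theorem eigenvalue_sq_pow_le (hn : 4 ≤ n) (hq : 2 ≤ q) (Y : Matrix (Fin n) (Fin n) (ZMod q))
    (t : ℕ) :
    ((1 - rectDefect Y / ((n : ℝ) ^ 2 * ((n : ℝ) - 1) ^ 2)) ^ t) ^ 2 ≤
      Real.exp (-(2 * t * ((1 - Real.cos (2 * Real.pi / q)) * rectCount Y / n ^ 4)))
        + Real.exp (-(2 * t)) := by
  have hn' : (4 : ℝ) ≤ n := by exact_mod_cast hn
  have hκ := one_sub_cos_pos hq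
  have hn₁ : (0 : ℝ) < (n : ℝ) - 1 := by linarith
  have hS₁ := mul_rectCount_le_rectDefect Y
  have hS₂ := rectDefect_le Y
  have hS₀ := rectDefect_nonneg Y
  have hlow : -(1 / 3 : ℝ) ≤ 1 - rectDefect Y / ((n : ℝ) ^ 2 * ((n : ℝ) - 1) ^ 2) := by
    have : rectDefect Y / ((n : ℝ) ^ 2 * ((n : ℝ) - 1) ^ 2) ≤ 4 / 3 := by
      rw [div_le_iff₀ (by positivity)]
      have : (n : ℝ) ^ 2 * (n - 1) * n ≤ (n : ℝ) ^ 2 * (n - 1) * (4 / 3 * (n - 1)) := by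
        gcongr
        linarith
      linarith
    linarith
  have hup : (1 - Real.cos (2 * Real.pi / q)) * rectCount Y / n ^ 4 ≤
      rectDefect Y / ((n : ℝ) ^ 2 * ((n : ℝ) - 1) ^ 2) := by
    apply div_le_div₀ hS₀ hS₁ (by positivity)
    rw [show (n : ℝ) ^ 4 = n ^ 2 * n ^ 2 by ring]
    gcongr
    linarith
  set lam := 1 - rectDefect Y / ((n : ℝ) ^ 2 * ((n : ℝ) - 1) ^ 2) with hlam
  set E := (1 - Real.cos (2 * Real.pi / q)) * rectCount Y / n ^ 4
  have hpow : ∀ b : ℝ, |lam| ≤ Real.exp (-b) → (lam ^ t) ^ 2 ≤ Real.exp (-(2 * t * b)) := by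
    intro b hb
    calc (lam ^ t) ^ 2 = |lam| ^ (2 * t) := by
          rw [← pow_mul, mul_comm t 2, pow_mul, pow_mul, sq_abs]
      _ ≤ Real.exp (-b) ^ (2 * t) := pow_le_pow_left₀ (abs_nonneg _) hb _
      _ = Real.exp (-(2 * t * b)) := by
          rw [← Real.exp_nat_mul]; push_cast; ring_nf
  rcases le_total 0 lam with h0 | h0
  · refine (hpow E ?_).trans (le_add_of_nonneg_right (Real.exp_pos _).le)
    rw [abs_of_nonneg h0]
    have := Real.add_one_le_exp (-E)
    linarith
  · have := hpow 1 (by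
      rw [abs_of_nonpos h0]
      have := Real.exp_neg_one_gt_d9
      norm_num at this ⊢
      linarith)
    rw [mul_one] at this
    exact this.trans (le_add_of_nonneg_left (Real.exp_pos _).le)

end SpectralBounds

section Equilibrium

open ZMod

variable {n q : ℕ}

theorem DGmat_row_sum (a b c d : ℕ) (i : Fin n) (hc : c ∈ Finset.Icc 1 n)
    (hd : d ∈ Finset.Icc 1 n) : ∑ k, DGmat n q a b c d i k = 0 := by
  obtain ⟨c, rfl⟩ : ∃ c' : Fin n, (c' : ℕ) + 1 = c := by
    rw [Finset.mem_Icc] at hc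
    exact ⟨⟨c - 1, by omega⟩, by simp; omega⟩
  obtain ⟨d, rfl⟩ : ∃ d' : Fin n, (d' : ℕ) + 1 = d := by
    rw [Finset.mem_Icc] at hd
    exact ⟨⟨d - 1, by omega⟩, by simp; omega⟩
  simp only [DGmat, Matrix.of_apply, add_left_inj, Fin.val_inj, Finset.sum_add_distrib,
    Finset.sum_sub_distrib, ite_and]
  by_cases h₁ : (i : ℕ) + 1 = a <;> by_cases h₂ : (i : ℕ) + 1 = b <;> simp [h₁, h₂]

theorem DGmat_col_sum (a b c d : ℕ) (k : Fin n) (ha : a ∈ Finset.Icc 1 n)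
    (hb : b ∈ Finset.Icc 1 n) : ∑ i, DGmat n q a b c d i k = 0 := by
  rw [← DGmat_row_sum (q := q) c d a b k ha hb]
  refine Finset.sum_congr rfl fun i _ => ?_
  simp only [DGmat, Matrix.of_apply, and_comm]
  ring

theorem stepPMF_eq_zero {g : Matrix (Fin n) (Fin n) (ZMod q)}
    (hg : ¬((∀ i, ∑ j, g i j = 0) ∧ ∀ j, ∑ i, g i j = 0)) : stepPMF n q g = 0 := by
  unfold stepPMF
  rw [Finset.card_eq_zero.2, Nat.cast_zero, zero_div]
  rw [Finset.filter_eq_empty_iff]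
  rintro ⟨⟨⟨a, b⟩, ⟨c, d⟩⟩, s⟩ hp ⟨-, -, h⟩
  simp only [Finset.mem_product] at hp
  apply hg
  rw [← h]
  cases s
  · simp [DGmat_row_sum _ _ _ _ _ hp.1.2.1 hp.1.2.2, DGmat_col_sum _ _ _ _ _ hp.1.1.1 hp.1.1.2]
  · simp [DGmat_row_sum _ _ _ _ _ hp.1.2.1 hp.1.2.2, DGmat_col_sum _ _ _ _ _ hp.1.1.1 hp.1.1.2]

variable [NeZero q] {r c : Fin n → ZMod q} {x : Matrix (Fin n) (Fin n) (ZMod q)}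

theorem mem_OmegaSet {z : Matrix (Fin n) (Fin n) (ZMod q)} :
    z ∈ OmegaSet n q r c ↔ (∀ i, ∑ j, z i j = r i) ∧ ∀ j, ∑ i, z i j = c j := by
  simp [OmegaSet]

theorem add_mem_OmegaSet_iff {z A : Matrix (Fin n) (Fin n) (ZMod q)}
    (hr : ∀ i, ∑ j, A i j = 0) (hc : ∀ j, ∑ i, A i j = 0) :
    z + A ∈ OmegaSet n q r c ↔ z ∈ OmegaSet n q r c := by
  simp [mem_OmegaSet, Finset.sum_add_distrib, hr, hc]

theorem walkDist_eq_zero (hx : x ∈ OmegaSet n q r c) (t : ℕ)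
    {z : Matrix (Fin n) (Fin n) (ZMod q)} (hz : z ∉ OmegaSet n q r c) :
    walkDist n q x t z = 0 := by
  induction t generalizing z with
  | zero =>
    have : z ≠ x := by rintro rfl; exact hz hx
    simp [walkDist, this]
  | succ t ih =>
    refine Finset.sum_eq_zero fun g _ => ?_
    by_cases hg : g ∈ OmegaSet n q r c
    · rw [stepPMF_eq_zero, mul_zero]
      rintro ⟨hr, hc⟩
      apply hz
      rw [← add_sub_cancel g z]
      exact (add_mem_OmegaSet_iff hr hc).2 hg
    · rw [ih hg, zero_mul]

theorem IsAdditive.pairing_eq {Y z : Matrix (Fin n) (Fin n) (ZMod q)} (hY : IsAdditive Y)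
    (hz : z ∈ OmegaSet n q r c) (hx : x ∈ OmegaSet n q r c) : pairing Y z = pairing Y x := by
  rcases Nat.eq_zero_or_pos n with rfl | hn
  · simp [pairing]
  have key : ∀ w ∈ OmegaSet n q r c, pairing Y w = ∑ i, Y i ⟨0, hn⟩ * r i
      + ∑ k, (Y ⟨0, hn⟩ k - Y ⟨0, hn⟩ ⟨0, hn⟩) * c k := by
    intro w hw
    rw [mem_OmegaSet] at hw
    simp_rw [← hw.1, ← hw.2, Finset.mul_sum]
    rw [Finset.sum_comm (f := fun k i => (Y ⟨0, hn⟩ k - Y ⟨0, hn⟩ ⟨0, hn⟩) * w i k),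
      ← Finset.sum_add_distrib]
    simp_rw [← Finset.sum_add_distrib]
    refine Finset.sum_congr rfl fun i _ => Finset.sum_congr rfl fun k _ => ?_
    have h := hY i ⟨0, hn⟩ k ⟨0, hn⟩
    rw [rectSum] at h
    linear_combination w i k * h
  rw [key z hz, key x hx]

theorem fourierTransform_unifOmega_of_isAdditive {Y : Matrix (Fin n) (Fin n) (ZMod q)}
    (hY : IsAdditive Y) (hx : x ∈ OmegaSet n q r c) :
    fourierTransform (unifOmega n q r c) Y = stdAddChar (pairing Y x) := by
  have hN : ((OmegaSet n q r c).card : ℂ) ≠ 0 := by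
    exact_mod_cast (Finset.card_pos.2 ⟨x, hx⟩).ne'
  have h : ∀ z, (unifOmega n q r c z : ℂ) * stdAddChar (pairing Y z) =
      if z ∈ OmegaSet n q r c then stdAddChar (pairing Y x) / (OmegaSet n q r c).card else 0 := by
    intro z
    unfold unifOmega
    split_ifs with hz
    · rw [hY.pairing_eq hz hx]
      push_cast
      ring
    · simp
  unfold fourierTransform
  simp_rw [h]
  rw [← Finset.sum_filter, Finset.filter_univ_mem, Finset.sum_const, nsmul_eq_mul]
  field_simp

theorem fourierTransform_unifOmega_of_not_isAdditive {Y : Matrix (Fin n) (Fin n) (ZMod q)}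
    (hY : ¬IsAdditive Y) : fourierTransform (unifOmega n q r c) Y = 0 := by
  unfold IsAdditive at hY
  push Not at hY
  obtain ⟨i, j, k, l, h⟩ := hY
  have hmem : ∀ a : Fin n, (a : ℕ) + 1 ∈ Finset.Icc 1 n := fun a => by
    rw [Finset.mem_Icc]; omega
  set A := DGmat n q (i + 1) (j + 1) (k + 1) (l + 1)
  have hA : ∀ z, unifOmega n q r c (z + A) = unifOmega n q r c z := by
    intro z
    unfold unifOmega
    rw [if_congr (add_mem_OmegaSet_iff (fun _ => DGmat_row_sum _ _ _ _ _ (hmem k) (hmem l))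
      fun _ => DGmat_col_sum _ _ _ _ _ (hmem i) (hmem j)) rfl rfl]
  have heq : fourierTransform (unifOmega n q r c) Y =
      fourierTransform (unifOmega n q r c) Y * stdAddChar (rectSum Y i j k l) := by
    conv_lhs => rw [fourierTransform, ← Equiv.sum_comp (Equiv.addRight A)]
    simp only [Equiv.coe_addRight, hA, pairing_add_right, AddChar.map_add_eq_mul, A, pairing_DGmat]
    rw [fourierTransform, Finset.sum_mul]
    exact Finset.sum_congr rfl fun z _ => by ring
  by_contra hne
  apply h
  apply injective_stdAddChar
  rw [AddChar.map_zero_eq_one]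
  exact (mul_eq_left₀ hne).1 heq.symm

theorem fourierTransform_sub (f g : Matrix (Fin n) (Fin n) (ZMod q) → ℝ)
    (Y : Matrix (Fin n) (Fin n) (ZMod q)) :
    fourierTransform (fun z => f z - g z) Y = fourierTransform f Y - fourierTransform g Y := by
  simp [fourierTransform, sub_mul]

theorem IsAdditive.rectDefect_eq_zero {Y : Matrix (Fin n) (Fin n) (ZMod q)} (hY : IsAdditive Y) :
    rectDefect Y = 0 := by
  unfold rectDefect
  simp [hY _ _ _ _]

open Classical in
theorem card_OmegaSet_mul_card_isAdditive_le (hx : x ∈ OmegaSet n q r c) :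
    ((OmegaSet n q r c).card : ℝ)
      * (Finset.univ.filter fun Y : Matrix (Fin n) (Fin n) (ZMod q) => IsAdditive Y).card ≤
      (q : ℝ) ^ (n ^ 2) := by
  have hN : (0 : ℝ) < (OmegaSet n q r c).card := by exact_mod_cast Finset.card_pos.2 ⟨x, hx⟩
  have h := sum_norm_sq_fourierTransform (unifOmega n q r c)
  have h₁ : ∑ z, unifOmega n q r c z ^ 2 = 1 / ((OmegaSet n q r c).card : ℝ) := by
    unfold unifOmega
    simp only [ite_pow, ne_eq, OfNat.ofNat_ne_zero, not_false_eq_true, zero_pow]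
    rw [← Finset.sum_filter, Finset.filter_univ_mem, Finset.sum_const, nsmul_eq_mul]
    field_simp
  have h₂ : ((Finset.univ.filter fun Y : Matrix (Fin n) (Fin n) (ZMod q) => IsAdditive Y).card : ℝ)
      ≤ ∑ Y, ‖fourierTransform (unifOmega n q r c) Y‖ ^ 2 := by
    rw [Finset.card_filter]
    push_cast
    refine Finset.sum_le_sum fun Y _ => ?_
    split_ifs with hY
    · rw [fourierTransform_unifOmega_of_isAdditive hY hx, stdAddChar_apply, Circle.norm_coe]
      norm_num
    · positivity
  rw [h, h₁, mul_one_div, le_div_iff₀ hN] at h₂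
  linarith

open Classical in
theorem sq_sum_abs_walkDist_sub_le (hn : 2 ≤ n) (hx : x ∈ OmegaSet n q r c) (t : ℕ) :
    (q : ℝ) ^ (n ^ 2) * (∑ z, |walkDist n q x t z - unifOmega n q r c z|) ^ 2 ≤
      (OmegaSet n q r c).card * ∑ Y : Matrix (Fin n) (Fin n) (ZMod q), if IsAdditive Y then 0 else
        ((1 - rectDefect Y / ((n : ℝ) ^ 2 * ((n : ℝ) - 1) ^ 2)) ^ t) ^ 2 := by
  have hpars := sum_norm_sq_fourierTransform (n := n) (q := q)
    fun z => walkDist n q x t z - unifOmega n q r c z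
  have hft : ∀ Y : Matrix (Fin n) (Fin n) (ZMod q),
      ‖fourierTransform (fun z => walkDist n q x t z - unifOmega n q r c z) Y‖ ^ 2 =
      if IsAdditive Y then 0 else
        ((1 - rectDefect Y / ((n : ℝ) ^ 2 * ((n : ℝ) - 1) ^ 2)) ^ t) ^ 2 := by
    intro Y
    rw [fourierTransform_sub, fourierTransform_walkDist hn]
    split_ifs with hY
    · rw [fourierTransform_unifOmega_of_isAdditive hY hx, hY.rectDefect_eq_zero]
      simp
    · rw [fourierTransform_unifOmega_of_not_isAdditive hY, sub_zero, norm_mul, stdAddChar_apply,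
        Circle.norm_coe, one_mul, norm_pow, Complex.norm_real, Real.norm_eq_abs, ← abs_pow, sq_abs]
  simp_rw [hft] at hpars
  rw [hpars]
  have hsupp : ∑ z, |walkDist n q x t z - unifOmega n q r c z| =
      ∑ z ∈ OmegaSet n q r c, |walkDist n q x t z - unifOmega n q r c z| := by
    refine (Finset.sum_subset (Finset.subset_univ _) fun z _ hz => ?_).symm
    simp [walkDist_eq_zero hx t hz, unifOmega, hz]
  have hcs := sq_sum_le_card_mul_sum_sq (s := OmegaSet n q r c)
    (f := fun z => |walkDist n q x t z - unifOmega n q r c z|)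
  simp only [sq_abs] at hcs
  have hle : ∑ z ∈ OmegaSet n q r c, (walkDist n q x t z - unifOmega n q r c z) ^ 2 ≤
      ∑ z, (walkDist n q x t z - unifOmega n q r c z) ^ 2 :=
    Finset.sum_le_sum_of_subset_of_nonneg (Finset.subset_univ _) fun z _ _ => sq_nonneg _
  rw [hsupp, mul_left_comm]
  refine mul_le_mul_of_nonneg_left (hcs.trans ?_) (by positivity)
  exact mul_le_mul_of_nonneg_left hle (by positivity)

end Equilibrium

section Counting

variable {n q : ℕ}

theorem rectSum_add (Y K : Matrix (Fin n) (Fin n) (ZMod q)) (i j k l : Fin n) :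
    rectSum (Y + K) i j k l = rectSum Y i j k l + rectSum K i j k l := by
  simp only [rectSum, Matrix.add_apply]
  ring

theorem IsAdditive.add {Y K : Matrix (Fin n) (Fin n) (ZMod q)} (hY : IsAdditive Y)
    (hK : IsAdditive K) : IsAdditive (Y + K) := fun i j k l => by
  rw [rectSum_add, hY, hK, add_zero]

theorem IsAdditive.neg {Y : Matrix (Fin n) (Fin n) (ZMod q)} (hY : IsAdditive Y) :
    IsAdditive (-Y) := fun i j k l => by
  have h := hY i j k l
  simp only [rectSum, Matrix.neg_apply] at h ⊢
  linear_combination -h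

theorem isAdditive_zero : IsAdditive (0 : Matrix (Fin n) (Fin n) (ZMod q)) := fun i j k l => by
  simp [rectSum]

/-- The number of nonzero entries. -/
def natWeight (Z : Matrix (Fin n) (Fin n) (ZMod q)) : ℕ :=
  ∑ i, ∑ k, if Z i k = 0 then 0 else 1

theorem cast_natWeight (Z : Matrix (Fin n) (Fin n) (ZMod q)) : (natWeight Z : ℝ) = weight Z := by
  simp [natWeight, weight]

theorem natWeight_le (Z : Matrix (Fin n) (Fin n) (ZMod q)) : natWeight Z ≤ n ^ 2 := by
  calc natWeight Z ≤ ∑ _i : Fin n, ∑ _k : Fin n, 1 :=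
        Finset.sum_le_sum fun _ _ => Finset.sum_le_sum fun _ _ => by split_ifs <;> omega
    _ = n ^ 2 := by simp [sq]

theorem natWeight_pos {Z : Matrix (Fin n) (Fin n) (ZMod q)} (hZ : ¬IsAdditive Z) :
    0 < natWeight Z := by
  by_contra h
  apply hZ
  have : Z = 0 := by
    ext i k
    have h0 : natWeight Z = 0 := by omega
    simp only [natWeight, Finset.sum_eq_zero_iff, Finset.mem_univ, true_imp_iff] at h0
    simpa using h0 i k
  rw [this]
  exact isAdditive_zero

theorem sum_half_pow_le (N : ℕ) : ∑ m ∈ Finset.Icc 1 N, (1 / 2 : ℝ) ^ m ≤ 1 := by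
  have h : ∑ m ∈ Finset.Icc 1 N, (1 / 2 : ℝ) ^ m = 1 - (1 / 2) ^ N := by
    induction N with
    | zero => simp
    | succ N ih =>
      rw [Finset.sum_Icc_succ_top (by omega), ih]
      ring
  rw [h]
  have : (0 : ℝ) ≤ (1 / 2) ^ N := by positivity
  linarith

variable [NeZero q]

theorem sum_pow_natWeight (y : ℝ) :
    ∑ Z : Matrix (Fin n) (Fin n) (ZMod q), y ^ natWeight Z = (1 + ((q : ℝ) - 1) * y) ^ (n ^ 2) := by
  have hentry : ∑ a : ZMod q, (if a = 0 then (1 : ℝ) else y) = 1 + ((q : ℝ) - 1) * y := by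
    rw [← Finset.add_sum_erase _ _ (Finset.mem_univ 0), if_pos rfl]
    congr 1
    rw [Finset.sum_congr rfl fun a ha => if_neg (Finset.ne_of_mem_erase ha), Finset.sum_const,
      Finset.card_erase_of_mem (Finset.mem_univ 0), Finset.card_univ, ZMod.card, nsmul_eq_mul,
      Nat.cast_pred (NeZero.pos q)]
  have hrow : ∑ v : Fin n → ZMod q, ∏ k, (if v k = 0 then (1 : ℝ) else y) =
      (1 + ((q : ℝ) - 1) * y) ^ n := by
    rw [← hentry, Fintype.sum_pow]
  have hpow : ∀ Z : Matrix (Fin n) (Fin n) (ZMod q),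
      y ^ natWeight Z = ∏ i, ∏ k, (if Z i k = 0 then (1 : ℝ) else y) := by
    intro Z
    simp_rw [natWeight, ← Finset.prod_pow_eq_pow_sum]
    refine Finset.prod_congr rfl fun i _ => Finset.prod_congr rfl fun k _ => ?_
    split_ifs <;> simp
  simp_rw [hpow]
  rw [sq, pow_mul, ← hrow, Fintype.sum_pow]
  rfl

theorem card_natWeight_eq_le (hn : 0 < n) {m : ℕ} (hm : 1 ≤ m) :
    ((Finset.univ.filter fun Z : Matrix (Fin n) (Fin n) (ZMod q) => natWeight Z = m).card : ℝ) ≤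
      Real.exp (m * (1 + Real.log ((n : ℝ) ^ 2 * q / m))) := by
  have hn' : (0 : ℝ) < n := by exact_mod_cast hn
  have hq' : (1 : ℝ) ≤ q := by exact_mod_cast NeZero.one_le
  have hm' : (0 : ℝ) < m := by exact_mod_cast hm
  set y : ℝ := m / ((n : ℝ) ^ 2 * q) with hy
  have hy₀ : 0 < y := by positivity
  have h₁ : ((Finset.univ.filter fun Z : Matrix (Fin n) (Fin n) (ZMod q) =>
      natWeight Z = m).card : ℝ) * y ^ m ≤ Real.exp m := by
    calc _ = ∑ Z ∈ Finset.univ.filter (fun Z : Matrix (Fin n) (Fin n) (ZMod q) =>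
            natWeight Z = m), y ^ natWeight Z := by
          rw [Finset.sum_congr rfl fun Z hZ => by rw [(Finset.mem_filter.1 hZ).2],
            Finset.sum_const, nsmul_eq_mul]
      _ ≤ ∑ Z : Matrix (Fin n) (Fin n) (ZMod q), y ^ natWeight Z :=
          Finset.sum_le_sum_of_subset_of_nonneg (Finset.subset_univ _) fun _ _ _ => by positivity
      _ = (1 + ((q : ℝ) - 1) * y) ^ (n ^ 2) := sum_pow_natWeight y
      _ ≤ Real.exp (q * y) ^ (n ^ 2) := by
          have := Real.add_one_le_exp (q * y)
          apply pow_le_pow_left₀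
          · nlinarith
          · linarith
      _ = Real.exp m := by
          rw [← Real.exp_nat_mul]
          congr 1
          rw [hy]
          push_cast
          field_simp
  have h₂ : y ^ m = Real.exp (-(m * Real.log ((n : ℝ) ^ 2 * q / m))) := by
    rw [← mul_neg, Real.exp_nat_mul, Real.exp_neg, Real.exp_log (by positivity), inv_div]
  rw [h₂, Real.exp_neg, ← div_eq_mul_inv, div_le_iff₀ (Real.exp_pos _), ← Real.exp_add] at h₁
  rwa [mul_add, mul_one]

open Classical in
theorem exists_isMinimal (Y : Matrix (Fin n) (Fin n) (ZMod q)) :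
    ∃ Z, IsMinimal Z ∧ IsAdditive (Y - Z) := by
  obtain ⟨K, hK, hmin⟩ := Finset.exists_min_image
    (Finset.univ.filter fun K : Matrix (Fin n) (Fin n) (ZMod q) => IsAdditive K)
    (fun K => weight (Y + K)) ⟨0, by simpa using isAdditive_zero⟩
  simp only [Finset.mem_filter, Finset.mem_univ, true_and] at hK hmin
  refine ⟨Y + K, fun L hL => ?_, ?_⟩
  · rw [add_assoc]
    exact hmin _ (hK.add hL)
  · rw [sub_add_cancel_left]
    exact hK.neg

open Classical in
theorem sum_not_isAdditive_le (f : Matrix (Fin n) (Fin n) (ZMod q) → ℝ) (hf₀ : ∀ Y, 0 ≤ f Y)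
    (hf : ∀ Y K, IsAdditive K → f (Y + K) = f Y) :
    (∑ Y, if IsAdditive Y then 0 else f Y) ≤
      (Finset.univ.filter fun Y : Matrix (Fin n) (Fin n) (ZMod q) => IsAdditive Y).card *
        ∑ Z, if IsMinimal Z ∧ ¬IsAdditive Z then f Z else 0 := by
  have hle : ∀ Y, (if IsAdditive Y then 0 else f Y) ≤
      ∑ Z, if IsAdditive (Y - Z) then (if IsMinimal Z ∧ ¬IsAdditive Z then f Z else 0) else 0 := by
    intro Y
    have hnn : ∀ Z, 0 ≤ if IsAdditive (Y - Z) then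
        (if IsMinimal Z ∧ ¬IsAdditive Z then f Z else 0) else 0 := by
      intro Z
      split_ifs <;> simp [hf₀]
    split_ifs with hY
    · exact Finset.sum_nonneg fun Z _ => hnn Z
    · obtain ⟨Z, hZ, hYZ⟩ := exists_isMinimal Y
      refine le_trans (le_of_eq ?_) (Finset.single_le_sum (fun Z _ => hnn Z) (Finset.mem_univ Z))
      have hZ' : ¬IsAdditive Z := fun h => hY (by simpa using hYZ.add h)
      rw [if_pos hYZ, if_pos ⟨hZ, hZ'⟩, ← hf Z _ hYZ, add_sub_cancel]
  refine (Finset.sum_le_sum fun Y _ => hle Y).trans (le_of_eq ?_)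
  rw [Finset.sum_comm, Finset.mul_sum]
  refine Finset.sum_congr rfl fun Z _ => ?_
  rw [← Equiv.sum_comp (Equiv.addRight Z)]
  simp only [Equiv.coe_addRight, add_sub_cancel_right]
  rw [← Finset.sum_filter, Finset.sum_const, nsmul_eq_mul]

open Classical in
theorem sum_isMinimal_exp_le (hn : 4 ≤ n) (hq : 2 ≤ q) {C t : ℝ}
    (hC : 640 / Real.log (Real.log (16 * n)) ≤ C)
    (ht : (n : ℝ) ^ 2 / (4 * (1 - Real.cos (2 * Real.pi / q))) * Real.log n
        + (n : ℝ) ^ 2 / (1 - Real.cos (2 * Real.pi / q)) * C * Real.log (Real.log (16 * n))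
          * Real.sqrt (Real.log n) * Real.log q ≤ t) :
    (∑ Z : Matrix (Fin n) (Fin n) (ZMod q), if IsMinimal Z ∧ ¬IsAdditive Z then
      Real.exp (-(2 * t * ((1 - Real.cos (2 * Real.pi / q)) * rectCount Z / n ^ 4)))
        + Real.exp (-(2 * t)) else 0) ≤ 2 * Real.exp (-(2 * C * Real.log q)) := by
  have hn' : (4 : ℝ) ≤ n := by exact_mod_cast hn
  have hq' : (2 : ℝ) ≤ q := by exact_mod_cast hq
  have hκ := one_sub_cos_pos hq
  set κ := 1 - Real.cos (2 * Real.pi / q) with hκdef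
  set E := Real.exp (-(2 * C * Real.log q)) with hE
  have hκ₂ : κ ≤ 2 := by
    have := Real.neg_one_le_cos (2 * Real.pi / q)
    linarith
  set G : ℕ → ℝ := fun m =>
    Real.exp (-(m * (1 + Real.log ((n : ℝ) ^ 2 * q / m)))) * ((1 / 2) ^ m * E) with hG
  have hG₀ : ∀ m, 0 ≤ G m := fun m => by positivity
  have hterm : ∀ Z : Matrix (Fin n) (Fin n) (ZMod q), IsMinimal Z → ¬IsAdditive Z →
      Real.exp (-(2 * t * (κ * rectCount Z / n ^ 4))) ≤ G (natWeight Z) := by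
    intro Z hZ hZ'
    have hm : (1 : ℝ) ≤ weight Z := by
      rw [← cast_natWeight]
      exact_mod_cast natWeight_pos hZ'
    have h := entropy_le_exponent hn' hq' hm hC hκ ht hZ.sq_mul_weight_le
      four_mul_weight_le_rectCount hZ.two_mul_weight_le_rectCount
    have hhalf : ((1 : ℝ) / 2) ^ natWeight Z = Real.exp (-(weight Z * Real.log 2)) := by
      rw [← cast_natWeight, ← mul_neg, Real.exp_nat_mul, Real.exp_neg, Real.exp_log (by norm_num)]
      norm_num
    simp only [hG, hE]
    rw [hhalf, cast_natWeight, ← Real.exp_add, ← Real.exp_add, Real.exp_le_exp]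
    linarith
  have h₁ : (∑ Z : Matrix (Fin n) (Fin n) (ZMod q), if IsMinimal Z ∧ ¬IsAdditive Z then
      Real.exp (-(2 * t * (κ * rectCount Z / n ^ 4))) else 0) ≤ E := by
    calc _ ≤ ∑ Z : Matrix (Fin n) (Fin n) (ZMod q),
            if 0 < natWeight Z then G (natWeight Z) else 0 := by
          refine Finset.sum_le_sum fun Z _ => ?_
          split_ifs with h h' h'
          · exact hterm Z h.1 h.2
          · exact absurd (natWeight_pos h.2) h'
          · exact hG₀ _
          · exact le_rfl
      _ = ∑ Z ∈ Finset.univ.filter (fun Z : Matrix (Fin n) (Fin n) (ZMod q) => 0 < natWeight Z),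
            G (natWeight Z) := (Finset.sum_filter _ _).symm
      _ = ∑ m ∈ Finset.Icc 1 (n ^ 2), ∑ Z ∈ (Finset.univ.filter
            (fun Z : Matrix (Fin n) (Fin n) (ZMod q) => 0 < natWeight Z)).filter
              (fun Z => natWeight Z = m), G (natWeight Z) := by
          refine (Finset.sum_fiberwise_of_maps_to (fun Z hZ => ?_) _).symm
          exact Finset.mem_Icc.2 ⟨(Finset.mem_filter.1 hZ).2, natWeight_le Z⟩
      _ ≤ ∑ m ∈ Finset.Icc 1 (n ^ 2), (1 / 2 : ℝ) ^ m * E := by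
          refine Finset.sum_le_sum fun m hm => ?_
          have hm₁ := (Finset.mem_Icc.1 hm).1
          rw [Finset.sum_congr rfl fun Z hZ => by rw [(Finset.mem_filter.1 hZ).2],
            Finset.sum_const, nsmul_eq_mul]
          have hcard := card_natWeight_eq_le (q := q) (show 0 < n by omega) hm₁
          have hsub : (((Finset.univ.filter
            (fun Z : Matrix (Fin n) (Fin n) (ZMod q) => 0 < natWeight Z)).filter
              (fun Z => natWeight Z = m)).card : ℝ) ≤ (Finset.univ.filter
                fun Z : Matrix (Fin n) (Fin n) (ZMod q) => natWeight Z = m).card := by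
            exact_mod_cast Finset.card_le_card
              (Finset.filter_subset_filter _ (Finset.subset_univ _))
          calc _ ≤ Real.exp (m * (1 + Real.log ((n : ℝ) ^ 2 * q / m))) * G m :=
                mul_le_mul_of_nonneg_right (hsub.trans hcard) (hG₀ m)
            _ = (1 / 2 : ℝ) ^ m * E := by
                simp only [hG]
                rw [← mul_assoc, ← Real.exp_add, add_neg_cancel, Real.exp_zero, one_mul]
      _ ≤ E := by
          rw [← Finset.sum_mul]
          exact mul_le_of_le_one_left (Real.exp_pos _).le (sum_half_pow_le _)
  have h₂ : (∑ Z : Matrix (Fin n) (Fin n) (ZMod q), if IsMinimal Z ∧ ¬IsAdditive Z then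
      Real.exp (-(2 * t)) else 0) ≤ E := by
    calc _ ≤ ∑ _Z : Matrix (Fin n) (Fin n) (ZMod q), Real.exp (-(2 * t)) := by
          refine Finset.sum_le_sum fun Z _ => ?_
          split_ifs
          · exact le_rfl
          · positivity
      _ = Real.exp (n ^ 2 * Real.log q) * Real.exp (-(2 * t)) := by
          rw [Finset.sum_const, Finset.card_univ, nsmul_eq_mul,
            show Fintype.card (Matrix (Fin n) (Fin n) (ZMod q)) =
              Fintype.card (Fin n → Fin n → ZMod q) from rfl]
          congr 1
          rw [← Nat.cast_pow, Real.exp_nat_mul, Real.exp_log (by linarith)]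
          simp [pow_mul, sq]
      _ ≤ E := by
          rw [← Real.exp_add, hE, Real.exp_le_exp]
          linarith [full_entropy_le_time hn' hq' hC hκ hκ₂ ht]
  calc _ = _ := Finset.sum_congr rfl fun Z _ => (ite_add_zero (P := IsMinimal Z ∧ ¬IsAdditive Z))
    _ ≤ 2 * E := by
        rw [Finset.sum_add_distrib]
        linarith

end Counting

theorem stmt0 (n q : ℕ) [NeZero q] (hn : 4 ≤ n) (hq : 2 ≤ q)
    (r c : Fin n → ZMod q) (hrc : ∑ i, r i = ∑ j, c j)
    (x : Matrix (Fin n) (Fin n) (ZMod q)) (hx : x ∈ OmegaSet n q r c)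
    (C : ℝ) (hC : 640 / Real.log (Real.log (16 * n)) ≤ C)
    (t : ℕ)
    (ht : (n : ℝ) ^ 2 / (4 * (1 - Real.cos (2 * Real.pi / q))) * Real.log n
        + (n : ℝ) ^ 2 / (1 - Real.cos (2 * Real.pi / q)) * C * Real.log (Real.log (16 * n))
          * Real.sqrt (Real.log n) * Real.log q ≤ t) :
    tvDist (walkDist n q x t) (unifOmega n q r c) ≤ (q : ℝ) ^ (-C) := by
  classical
  have hq' : (0 : ℝ) < q := by exact_mod_cast NeZero.pos q
  set S := ∑ z, |walkDist n q x t z - unifOmega n q r c z| with hS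
  have hS₀ : 0 ≤ S := Finset.sum_nonneg fun _ _ => abs_nonneg _
  have hinv : ∀ Y K : Matrix (Fin n) (Fin n) (ZMod q), IsAdditive K →
      rectDefect (Y + K) = rectDefect Y := by
    intro Y K hK
    unfold rectDefect
    simp only [rectSum_add, hK _ _ _ _, add_zero]
  have h₁ := sq_sum_abs_walkDist_sub_le (by omega) hx t
  have h₂ := sum_not_isAdditive_le (n := n) (q := q)
    (fun Y => ((1 - rectDefect Y / ((n : ℝ) ^ 2 * ((n : ℝ) - 1) ^ 2)) ^ t) ^ 2)
    (fun Y => sq_nonneg _) (fun Y K hK => by simp only [hinv Y K hK])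
  have h₃ : (∑ Z : Matrix (Fin n) (Fin n) (ZMod q), if IsMinimal Z ∧ ¬IsAdditive Z then
      ((1 - rectDefect Z / ((n : ℝ) ^ 2 * ((n : ℝ) - 1) ^ 2)) ^ t) ^ 2 else 0) ≤
      2 * Real.exp (-(2 * C * Real.log q)) := by
    refine le_trans (Finset.sum_le_sum fun Z _ => ?_) (sum_isMinimal_exp_le hn hq hC ht)
    split_ifs
    · exact eigenvalue_sq_pow_le hn hq Z t
    · exact le_rfl
  have h₄ := card_OmegaSet_mul_card_isAdditive_le hx
  have hE : Real.exp (-(2 * C * Real.log q)) = ((q : ℝ) ^ (-C)) ^ 2 := by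
    rw [Real.rpow_def_of_pos hq', ← Real.exp_nat_mul]
    congr 1
    push_cast
    ring
  have h₅ : (q : ℝ) ^ (n ^ 2) * S ^ 2 ≤ (q : ℝ) ^ (n ^ 2) * (2 * ((q : ℝ) ^ (-C)) ^ 2) := by
    rw [hE] at h₃
    calc _ ≤ _ := h₁
      _ ≤ _ := mul_le_mul_of_nonneg_left
          (h₂.trans (mul_le_mul_of_nonneg_left h₃ (Nat.cast_nonneg _))) (Nat.cast_nonneg _)
      _ ≤ _ := by
          rw [← mul_assoc]
          exact mul_le_mul_of_nonneg_right h₄ (by positivity)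
  have h₆ := le_of_mul_le_mul_left h₅ (by positivity)
  have hpos : 0 < (q : ℝ) ^ (-C) := Real.rpow_pos_of_pos hq' _
  have h₇ : S ≤ 2 * (q : ℝ) ^ (-C) := by nlinarith
  rw [tvDist]
  linarith
end

section
/- Let n ≥ 4 and q ≥ 2 be integers, let (r_1,…,r_n), (c_1,…,c_n) ∈ (ℤ/qℤ)^n with Σ r_i = Σ c_j, and let x ∈ Ω. Let c ≥ 0 be a real number. If t is a nonnegative integer with t ≤ (n²/(4(1−cos(2π/q))))·log n − (n²/(4(1−cos(2π/q))))·(c+12)·log q, then ‖law(B_t) − Uniform(Ω)‖_TV ≥ 1 − q^{−c}, where B_t is the Diaconis–Gangolli chain started at x. -/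
open Finset

/-- Pairs `(i, j)` with `1 ≤ i < j ≤ n`. -/
def orderedPairs (n : ℕ) : Finset (ℕ × ℕ) :=
  (Icc 1 n ×ˢ Icc 1 n).filter fun p => p.1 < p.2

/-- Indicator that the `a`-th row (or column) is one of the two selected by `p`. -/
def touch {n : ℕ} (a : Fin n) (p : ℕ × ℕ) : ℝ :=
  if (a : ℕ) + 1 = p.1 ∨ (a : ℕ) + 1 = p.2 then 1 else 0

lemma touch_mem {n : ℕ} (a : Fin n) (p : ℕ × ℕ) : touch a p = 0 ∨ touch a p = 1 := by
  unfold touch; split_ifs <;> simp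

lemma touch_mul_self {n : ℕ} (a : Fin n) (p : ℕ × ℕ) : touch a p * touch a p = touch a p := by
  rcases touch_mem a p with h | h <;> simp [h]

lemma sum_touch {n : ℕ} (a : Fin n) : ∑ p ∈ orderedPairs n, touch a p = (n : ℝ) - 1 := by
  have hcard : ((orderedPairs n).filter
      fun p => (a : ℕ) + 1 = p.1 ∨ (a : ℕ) + 1 = p.2).card = n - 1 := by
    have : ((orderedPairs n).filter fun p => (a : ℕ) + 1 = p.1 ∨ (a : ℕ) + 1 = p.2)
        = ((Icc 1 n).erase ((a : ℕ) + 1)).image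
          fun b : ℕ => (min b ((a : ℕ) + 1), max b ((a : ℕ) + 1)) := by
      ext ⟨i, j⟩
      simp only [orderedPairs, mem_filter, mem_product, mem_Icc, mem_image, mem_erase,
        Prod.mk.injEq]
      constructor
      · rintro ⟨⟨h1, h2⟩, h3 | h3⟩
        · exact ⟨j, by omega⟩
        · exact ⟨i, by omega⟩
      · rintro ⟨b, h1, h2⟩
        have := a.2
        omega
    rw [this, card_image_of_injOn, card_erase_of_mem]
    · simp
    · simp
    · intro b hb b' hb' h
      simp only [Prod.mk.injEq] at h
      simp at hb hb'
      omega
  unfold touch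
  rw [← sum_filter, sum_const, hcard, nsmul_eq_mul, mul_one, Nat.cast_sub, Nat.cast_one]
  exact Nat.one_le_of_lt a.2

lemma card_orderedPairs (n : ℕ) : ((orderedPairs n).card : ℝ) = n.choose 2 := by
  have h1 : ∀ p ∈ orderedPairs n, ∑ a : Fin n, touch a p = 2 := by
    rintro ⟨i, j⟩ hp
    simp only [orderedPairs, mem_filter, mem_product, mem_Icc] at hp
    have hi : i - 1 < n := by omega
    have hj : j - 1 < n := by omega
    have : (univ.filter fun a : Fin n => (a : ℕ) + 1 = i ∨ (a : ℕ) + 1 = j)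
        = {⟨i - 1, hi⟩, ⟨j - 1, hj⟩} := by
      ext a
      simp only [mem_filter, mem_univ, true_and, mem_insert, mem_singleton, Fin.ext_iff]
      omega
    unfold touch
    rw [← sum_filter, this, sum_const, card_pair]
    · norm_num
    · simp only [ne_eq, Fin.mk.injEq]; omega
  have h2 : ∑ p ∈ orderedPairs n, ∑ a : Fin n, touch a p = n * (n - 1) := by
    rw [sum_comm]; simp only [sum_touch, sum_const, card_univ, Fintype.card_fin, nsmul_eq_mul]
  rw [sum_congr rfl h1] at h2
  rw [Nat.cast_choose_two]
  simp at h2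
  linarith

lemma sum_touch_mul_le {n : ℕ} {a c : Fin n} (h : a ≠ c) :
    ∑ p ∈ orderedPairs n, touch a p * touch c p ≤ 1 := by
  have : ∀ p, touch a p * touch c p = if ((a : ℕ) + 1 = p.1 ∨ (a : ℕ) + 1 = p.2) ∧
      ((c : ℕ) + 1 = p.1 ∨ (c : ℕ) + 1 = p.2) then 1 else 0 := by
    intro p; unfold touch; split_ifs <;> simp_all
  simp_rw [this]
  rw [← sum_filter, sum_const, nsmul_eq_mul, mul_one]
  norm_cast
  rw [card_le_one]
  have h' : (a : ℕ) ≠ c := fun hh => h (Fin.ext hh)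
  rintro ⟨i, j⟩ hp ⟨i', j'⟩ hp'
  simp only [orderedPairs, mem_filter, mem_product, mem_Icc] at hp hp'
  simp only [Prod.mk.injEq]
  omega

/-- Upper bound for the number of pairs selecting both `a` and `c`. -/
noncomputable def pairCount {n : ℕ} (a c : Fin n) : ℝ := if a = c then (n : ℝ) - 1 else 1

lemma sum_touch_mul_le_pairCount {n : ℕ} (a c : Fin n) :
    ∑ p ∈ orderedPairs n, touch a p * touch c p ≤ pairCount a c := by
  unfold pairCount
  split_ifs with h
  · subst h; simp only [touch_mul_self, sum_touch, le_refl]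
  · exact sum_touch_mul_le h

lemma sum_touch_mul_nonneg {n : ℕ} (a c : Fin n) :
    0 ≤ ∑ p ∈ orderedPairs n, touch a p * touch c p :=
  sum_nonneg fun p _ => by
    rcases touch_mem a p with h | h <;> rcases touch_mem c p with h' | h' <;> simp [h, h']

/-- The move selecting the rows `p.1` and the columns `p.2`. -/
def moveMat (n q : ℕ) (p : (ℕ × ℕ) × (ℕ × ℕ)) : Matrix (Fin n) (Fin n) (ZMod q) :=
  DGmat n q p.1.1 p.1.2 p.2.1 p.2.2

/-- The (real) Fourier coefficient of the step distribution at a character. -/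
noncomputable def stepCoeff {n q : ℕ} (χ : AddChar (Matrix (Fin n) (Fin n) (ZMod q)) ℂ) : ℝ :=
  (∑ p ∈ orderedPairs n ×ˢ orderedPairs n, (χ (moveMat n q p)).re) / (n.choose 2 : ℝ) ^ 2

lemma sum_stepPMF_mul {n q : ℕ} [NeZero q] (χ : AddChar (Matrix (Fin n) (Fin n) (ZMod q)) ℂ) :
    ∑ g, (stepPMF n q g : ℂ) * χ g = stepCoeff χ := by
  have key : ∀ g, (stepPMF n q g : ℂ) = (∑ p ∈ orderedPairs n ×ˢ orderedPairs n,
      ((if moveMat n q p = g then 1 else 0) + if - moveMat n q p = g then 1 else 0))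
        / (2 * (n.choose 2 : ℂ) ^ 2) := by
    intro g
    unfold stepPMF
    push_cast
    congr 1
    rw [card_filter, sum_product]
    simp only [Fintype.sum_bool, if_true, orderedPairs]
    rw [← filter_product, sum_filter]
    push_cast
    refine sum_congr rfl fun p _ => ?_
    simp only [moveMat]
    by_cases h1 : p.1.1 < p.1.2 <;> by_cases h2 : p.2.1 < p.2.2 <;> simp [h1, h2]
    congr
  simp_rw [key, div_mul_eq_mul_div, sum_mul]
  rw [← sum_div, sum_comm]
  unfold stepCoeff
  push_cast
  rw [mul_comm (2 : ℂ), ← div_div, div_right_comm]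
  congr 1
  rw [sum_div]
  refine sum_congr rfl fun p _ => ?_
  simp only [add_mul, ite_mul, one_mul, zero_mul, sum_add_distrib, sum_ite_eq, mem_univ, if_true]
  rw [AddChar.map_neg_eq_conj, Complex.add_conj]
  push_cast
  ring

lemma sum_walkDist_mul {n q : ℕ} [NeZero q] (x : Matrix (Fin n) (Fin n) (ZMod q))
    (χ : AddChar (Matrix (Fin n) (Fin n) (ZMod q)) ℂ) (t : ℕ) :
    ∑ z, (walkDist n q x t z : ℂ) * χ (z - x) = (stepCoeff χ : ℂ) ^ t := by
  induction t with
  | zero =>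
    rw [sum_eq_single x (fun z _ hz => by simp [walkDist, hz]) (by simp)]
    simp [walkDist]
  | succ t ih =>
    rw [pow_succ, ← ih, ← sum_stepPMF_mul, sum_mul]
    simp only [walkDist]
    push_cast
    simp_rw [sum_mul]
    rw [sum_comm]
    refine sum_congr rfl fun g _ => ?_
    rw [mul_sum, ← Equiv.sum_comp (Equiv.subRight g) (fun z => _ * ((stepPMF n q z : ℂ) * χ z))]
    refine sum_congr rfl fun z _ => ?_
    have : z - x = (z - g) + (g - x) := by abel
    rw [this, AddChar.map_add_eq_mul]
    simp only [Equiv.subRight_apply]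
    ring

lemma stepPMF_nonneg (n q : ℕ) (g : Matrix (Fin n) (Fin n) (ZMod q)) : 0 ≤ stepPMF n q g := by
  unfold stepPMF; positivity

lemma walkDist_nonneg {n q : ℕ} [NeZero q] (x : Matrix (Fin n) (Fin n) (ZMod q)) (t : ℕ) :
    ∀ z, 0 ≤ walkDist n q x t z := by
  induction t with
  | zero => intro z; simp only [walkDist]; split_ifs <;> simp
  | succ t ih => exact fun z => sum_nonneg fun g _ => mul_nonneg (ih g) (stepPMF_nonneg n q _)

lemma choose_two_pos {n : ℕ} (hn : 2 ≤ n) : (0 : ℝ) < n.choose 2 := by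
  exact_mod_cast Nat.choose_pos hn

lemma stepCoeff_one {n q : ℕ} (hn : 2 ≤ n) :
    stepCoeff (1 : AddChar (Matrix (Fin n) (Fin n) (ZMod q)) ℂ) = 1 := by
  have := choose_two_pos hn
  simp only [stepCoeff, AddChar.one_apply, Complex.one_re, sum_const, card_product, nsmul_eq_mul,
    Nat.cast_mul, card_orderedPairs]
  field_simp

lemma sum_walkDist {n q : ℕ} [NeZero q] (hn : 2 ≤ n) (x : Matrix (Fin n) (Fin n) (ZMod q))
    (t : ℕ) : ∑ z, walkDist n q x t z = 1 := by
  have := sum_walkDist_mul x 1 t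
  simp only [AddChar.one_apply, mul_one, stepCoeff_one hn, Complex.ofReal_one, one_pow] at this
  exact_mod_cast this

/-- The character reading off the entry `(e.1, e.2)`. -/
noncomputable def entryChar {n : ℕ} (q : ℕ) [NeZero q] (e : Fin n × Fin n) :
    AddChar (Matrix (Fin n) (Fin n) (ZMod q)) ℂ :=
  ZMod.stdAddChar.compAddMonoidHom (Matrix.entryAddMonoidHom (ZMod q) e.1 e.2)

lemma entryChar_apply {n q : ℕ} [NeZero q] (e : Fin n × Fin n)
    (A : Matrix (Fin n) (Fin n) (ZMod q)) :
    entryChar q e A = ZMod.stdAddChar (A e.1 e.2) := rfl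

/-- The character `A ↦ exp(2πi (A_e - A_f) / q)`. -/
noncomputable def pairChar {n : ℕ} (q : ℕ) [NeZero q] (e f : Fin n × Fin n) :
    AddChar (Matrix (Fin n) (Fin n) (ZMod q)) ℂ :=
  entryChar q e * (entryChar q f)⁻¹

lemma pairChar_apply {n q : ℕ} [NeZero q] (e f : Fin n × Fin n)
    (A : Matrix (Fin n) (Fin n) (ZMod q)) :
    pairChar q e f A = ZMod.stdAddChar (A e.1 e.2 - A f.1 f.2) := by
  rw [pairChar, AddChar.mul_apply, AddChar.inv_apply, sub_eq_add_neg, AddChar.map_add_eq_mul]; rfl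

/-- Both coordinates of `e` are selected by the move `p`. -/
def touchEntry {n : ℕ} (e : Fin n × Fin n) (p : (ℕ × ℕ) × (ℕ × ℕ)) : ℝ :=
  touch e.1 p.1 * touch e.2 p.2

lemma moveMat_entry {n q : ℕ} (e : Fin n × Fin n) {p : (ℕ × ℕ) × (ℕ × ℕ)}
    (hp : p ∈ orderedPairs n ×ˢ orderedPairs n) :
    (moveMat n q p e.1 e.2 = 0 ∧ touchEntry e p = 0) ∨
      ((moveMat n q p e.1 e.2 = 1 ∨ moveMat n q p e.1 e.2 = -1) ∧ touchEntry e p = 1) := by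
  obtain ⟨⟨i, j⟩, ⟨k, l⟩⟩ := p
  obtain ⟨a, b⟩ := e
  simp only [orderedPairs, mem_filter, mem_product, mem_Icc] at hp
  obtain ⟨⟨-, h1⟩, ⟨-, h2⟩⟩ := hp
  simp only [moveMat, DGmat, touchEntry, touch, Matrix.of_apply]
  have hij := h1.ne
  have hkl := h2.ne
  by_cases hi : (a : ℕ) + 1 = i
  · have hj : (a : ℕ) + 1 ≠ j := by omega
    by_cases hk : (b : ℕ) + 1 = k
    · have hl : (b : ℕ) + 1 ≠ l := by omega
      simp [hi, hk, hij, hkl]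
    · by_cases hl : (b : ℕ) + 1 = l <;> simp [hi, hk, hl, hij, hkl.symm]
  · by_cases hj : (a : ℕ) + 1 = j
    · by_cases hk : (b : ℕ) + 1 = k
      · have hl : (b : ℕ) + 1 ≠ l := by omega
        simp [hj, hk, hij.symm, hkl]
      · by_cases hl : (b : ℕ) + 1 = l <;> simp [hj, hk, hl, hij.symm, hkl.symm]
    · simp [hi, hj]

lemma re_stdAddChar_one (q : ℕ) [NeZero q] :
    (ZMod.stdAddChar (1 : ZMod q) : ℂ).re = Real.cos (2 * Real.pi / q) := by
  have := ZMod.stdAddChar_coe (N := q) 1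
  rw [Int.cast_one] at this
  rw [this, Complex.exp_re]
  have h : (2 * Real.pi * Complex.I * ((1 : ℤ) : ℂ) / (q : ℂ))
      = ((2 * Real.pi / q : ℝ) : ℂ) * Complex.I := by push_cast; ring
  rw [h]
  simp

lemma re_stdAddChar_neg_one (q : ℕ) [NeZero q] :
    (ZMod.stdAddChar (-1 : ZMod q) : ℂ).re = Real.cos (2 * Real.pi / q) := by
  rw [AddChar.map_neg_eq_conj, Complex.conj_re, re_stdAddChar_one]

lemma re_stdAddChar_mem (q : ℕ) [NeZero q] (u : ZMod q) :
    -1 ≤ (ZMod.stdAddChar u : ℂ).re ∧ (ZMod.stdAddChar u : ℂ).re ≤ 1 := by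
  have h := Complex.abs_re_le_norm (ZMod.stdAddChar u : ℂ)
  rw [AddChar.norm_apply] at h
  exact abs_le.mp h

lemma sum_touchEntry {n : ℕ} (e : Fin n × Fin n) :
    ∑ p ∈ orderedPairs n ×ˢ orderedPairs n, touchEntry e p = ((n : ℝ) - 1) ^ 2 := by
  simp only [touchEntry]
  rw [sum_product]; dsimp only; rw [← sum_mul_sum, sum_touch, sum_touch, sq]

lemma sum_touchEntry_mul_le {n : ℕ} (e f : Fin n × Fin n) :
    ∑ p ∈ orderedPairs n ×ˢ orderedPairs n, touchEntry e p * touchEntry f p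
      ≤ pairCount e.1 f.1 * pairCount e.2 f.2 := by
  have : ∀ p, touchEntry e p * touchEntry f p
      = (touch e.1 p.1 * touch f.1 p.1) * (touch e.2 p.2 * touch f.2 p.2) := by
    intro p; simp only [touchEntry]; ring
  simp_rw [this]
  rw [sum_product]; dsimp only; rw [← sum_mul_sum]
  exact mul_le_mul (sum_touch_mul_le_pairCount _ _) (sum_touch_mul_le_pairCount _ _)
    (sum_touch_mul_nonneg _ _)
    ((sum_touch_mul_nonneg _ _).trans (sum_touch_mul_le_pairCount _ _))

lemma stepCoeff_entryChar {n q : ℕ} [NeZero q] (hn : 2 ≤ n) (e : Fin n × Fin n) :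
    stepCoeff (entryChar q e) = 1 - 4 * (1 - Real.cos (2 * Real.pi / q)) / (n : ℝ) ^ 2 := by
  have hpt : ∀ p ∈ orderedPairs n ×ˢ orderedPairs n, (entryChar q e (moveMat n q p)).re
      = 1 - (1 - Real.cos (2 * Real.pi / q)) * touchEntry e p := by
    intro p hp
    rw [entryChar_apply]
    rcases moveMat_entry (q := q) e hp with ⟨h, h'⟩ | ⟨h | h, h'⟩ <;> rw [h, h'] <;>
      simp [re_stdAddChar_one, re_stdAddChar_neg_one]
  unfold stepCoeff
  rw [sum_congr rfl hpt, sum_sub_distrib, ← mul_sum, sum_touchEntry, sum_const, card_product,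
    nsmul_eq_mul, mul_one]
  push_cast
  rw [card_orderedPairs, Nat.cast_choose_two]
  have h2 : (2 : ℝ) ≤ n := by exact_mod_cast hn
  have h0 : (n : ℝ) ≠ 0 := by linarith
  have h1 : (n : ℝ) - 1 ≠ 0 := by linarith
  field_simp
  ring

lemma re_pair_bounds {n q : ℕ} [NeZero q] (e f : Fin n × Fin n) {p : (ℕ × ℕ) × (ℕ × ℕ)}
    (hp : p ∈ orderedPairs n ×ˢ orderedPairs n) :
    (pairChar q e f (moveMat n q p)).re ≤
      1 - (1 - Real.cos (2 * Real.pi / q)) *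
        (touchEntry e p + touchEntry f p - 2 * (touchEntry e p * touchEntry f p)) ∧
    1 - 2 * (touchEntry e p + touchEntry f p)
      ≤ (pairChar q e f (moveMat n q p)).re := by
  rw [pairChar_apply]
  have hb := re_stdAddChar_mem q (moveMat n q p e.1 e.2 - moveMat n q p f.1 f.2)
  have hc := Real.neg_one_le_cos (2 * Real.pi / q)
  rcases moveMat_entry (q := q) e hp with ⟨h, h'⟩ | ⟨h, h'⟩ <;>
  rcases moveMat_entry (q := q) f hp with ⟨g, g'⟩ | ⟨g, g'⟩ <;> rw [h', g']
  · simp [h, g]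
  · rcases g with g | g <;> rw [h, g] <;>
      simp [re_stdAddChar_one, re_stdAddChar_neg_one] <;> linarith
  · rcases h with h | h <;> rw [h, g] <;>
      simp [re_stdAddChar_one, re_stdAddChar_neg_one] <;> linarith
  · constructor <;> linarith

lemma stepCoeff_pair_le {n q : ℕ} [NeZero q] (hn : 2 ≤ n) (e f : Fin n × Fin n) :
    stepCoeff (pairChar q e f) ≤
      1 - 2 * (4 * (1 - Real.cos (2 * Real.pi / q)) / (n : ℝ) ^ 2) *
        (1 - pairCount e.1 f.1 * pairCount e.2 f.2 / ((n : ℝ) - 1) ^ 2) := by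
  have h2 : (2 : ℝ) ≤ n := by exact_mod_cast hn
  have h0 : (0 : ℝ) < n := by linarith
  have h1 : (0 : ℝ) < (n : ℝ) - 1 := by linarith
  have hs : 0 ≤ 1 - Real.cos (2 * Real.pi / q) := by linarith [Real.cos_le_one (2 * Real.pi / q)]
  have hle : ∑ p ∈ orderedPairs n ×ˢ orderedPairs n,
      (pairChar q e f (moveMat n q p)).re ≤ (n.choose 2 : ℝ) ^ 2 -
        (1 - Real.cos (2 * Real.pi / q)) *
        (2 * ((n : ℝ) - 1) ^ 2 - 2 * (pairCount e.1 f.1 * pairCount e.2 f.2)) := by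
    refine (sum_le_sum fun p hp => (re_pair_bounds e f hp).1).trans ?_
    rw [sum_sub_distrib, ← mul_sum, sum_sub_distrib, sum_add_distrib, ← mul_sum, sum_touchEntry,
      sum_touchEntry, sum_const, card_product, nsmul_eq_mul, mul_one]
    push_cast
    rw [card_orderedPairs]
    have := mul_le_mul_of_nonneg_left (sum_touchEntry_mul_le e f) hs
    nlinarith
  unfold stepCoeff
  refine (div_le_div_of_nonneg_right hle (sq_nonneg _)).trans (le_of_eq ?_)
  rw [Nat.cast_choose_two]
  field_simp
  ring

lemma stepCoeff_pair_nonneg {n q : ℕ} [NeZero q] (hn : 4 ≤ n) (e f : Fin n × Fin n) :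
    0 ≤ stepCoeff (pairChar q e f) := by
  have h2 : (4 : ℝ) ≤ n := by exact_mod_cast hn
  unfold stepCoeff
  refine div_nonneg ?_ (sq_nonneg _)
  refine le_trans ?_ (sum_le_sum fun p hp => (re_pair_bounds e f hp).2)
  rw [sum_sub_distrib, ← mul_sum, sum_add_distrib, sum_touchEntry, sum_touchEntry, sum_const,
    card_product, nsmul_eq_mul, mul_one]
  push_cast
  rw [card_orderedPairs, Nat.cast_choose_two]
  nlinarith [mul_nonneg (sq_nonneg ((n : ℝ) - 1)) (by nlinarith : (0 : ℝ) ≤ (n : ℝ) ^ 2 - 16)]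

lemma one_sub_le_tvDist {X : Type*} [Fintype X] {ν π : X → ℝ} (hν : ∀ z, 0 ≤ ν z)
    (hπ : ∀ z, 0 ≤ π z) (hν1 : ∑ z, ν z = 1) (hπ1 : ∑ z, π z = 1) (f : X → ℂ) {m : ℝ}
    (hm : 0 < m) :
    1 - 2 / m ^ 2 * (∑ z, π z * Complex.normSq (f z) + ∑ z, ν z * Complex.normSq (f z - m))
      ≤ tvDist ν π := by
  have hpt : ∀ z, min (ν z) (π z) ≤
      2 / m ^ 2 * (π z * Complex.normSq (f z) + ν z * Complex.normSq (f z - m)) := by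
    intro z
    have h1 : m ^ 2 / 2 ≤ Complex.normSq (f z) + Complex.normSq (f z - m) := by
      simp only [Complex.normSq_apply, Complex.sub_re, Complex.ofReal_re, Complex.sub_im,
        Complex.ofReal_im, sub_zero]
      nlinarith [sq_nonneg (2 * (f z).re - m), sq_nonneg (f z).im]
    have h0 : 0 ≤ min (ν z) (π z) := le_min (hν z) (hπ z)
    have h2 : min (ν z) (π z) * (m ^ 2 / 2) ≤
        π z * Complex.normSq (f z) + ν z * Complex.normSq (f z - m) := by
      refine (mul_le_mul_of_nonneg_left h1 h0).trans ?_
      rw [mul_add]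
      exact add_le_add
        (mul_le_mul_of_nonneg_right (min_le_right _ _) (Complex.normSq_nonneg _))
        (mul_le_mul_of_nonneg_right (min_le_left _ _) (Complex.normSq_nonneg _))
    rw [div_mul_eq_mul_div, le_div_iff₀ (by positivity)]
    linarith
  have htv : tvDist ν π = 1 - ∑ z, min (ν z) (π z) := by
    have : ∀ z, |ν z - π z| = ν z + π z - 2 * min (ν z) (π z) := by
      intro z
      rcases le_total (ν z) (π z) with h | h
      · rw [min_eq_left h, abs_of_nonpos (by linarith)]; ring
      · rw [min_eq_right h, abs_of_nonneg (by linarith)]; ring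
    unfold tvDist
    simp_rw [this]
    rw [sum_sub_distrib, sum_add_distrib, ← mul_sum, hν1, hπ1]
    ring
  rw [htv, ← sum_add_distrib, mul_sum]
  linarith [sum_le_sum fun z (_ : z ∈ univ) => hpt z]

lemma pairChar_self {n q : ℕ} [NeZero q] (e : Fin n × Fin n) : pairChar q e e = 1 :=
  mul_inv_cancel _

/-- The sum of all entry characters, the test statistic. -/
noncomputable def entrySum {n q : ℕ} [NeZero q] (A : Matrix (Fin n) (Fin n) (ZMod q)) : ℂ :=
  ∑ e : Fin n × Fin n, entryChar q e A

lemma normSq_entrySum {n q : ℕ} [NeZero q] (A : Matrix (Fin n) (Fin n) (ZMod q)) :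
    (Complex.normSq (entrySum A) : ℂ) = ∑ e, ∑ f, pairChar q e f A := by
  rw [← Complex.mul_conj, entrySum, map_sum, sum_mul_sum]
  refine sum_congr rfl fun e _ => sum_congr rfl fun f _ => ?_
  rw [pairChar, AddChar.mul_apply, AddChar.inv_apply, AddChar.map_neg_eq_conj]

lemma sum_mul_normSq_entrySum {n q : ℕ} [NeZero q] (ρ : Matrix (Fin n) (Fin n) (ZMod q) → ℝ)
    (x : Matrix (Fin n) (Fin n) (ZMod q)) :
    ((∑ z, ρ z * Complex.normSq (entrySum (z - x)) : ℝ) : ℂ)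
      = ∑ e, ∑ f, ∑ z, (ρ z : ℂ) * pairChar q e f (z - x) := by
  push_cast
  simp_rw [normSq_entrySum, mul_sum]
  rw [sum_comm]
  exact sum_congr rfl fun e _ => sum_comm

lemma exists_table_zero_margins {n q : ℕ} [NeZero q] (hn : 3 ≤ n) (hq : 2 ≤ q)
    {e f : Fin n × Fin n} (hef : e ≠ f) :
    ∃ g : Matrix (Fin n) (Fin n) (ZMod q), (∀ i, ∑ j, g i j = 0) ∧ (∀ j, ∑ i, g i j = 0) ∧
      pairChar q e f g ≠ 1 := by
  have : Fact (1 < q) := ⟨hq⟩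
  obtain ⟨a, b⟩ := e
  obtain ⟨c, d⟩ := f
  have hex : ∀ u v : Fin n, ∃ w, w ≠ u ∧ w ≠ v := by
    intro u v
    obtain ⟨w, hw⟩ := exists_mem_notMem_of_card_lt_card (s := {u, v}) (t := (univ : Finset (Fin n)))
      (by rw [card_univ, Fintype.card_fin]; exact card_le_two.trans_lt hn)
    simp only [mem_insert, mem_singleton, not_or] at hw
    exact ⟨w, hw.2⟩
  obtain ⟨a', ha', hca'⟩ := hex a c
  obtain ⟨b', hb', hdb'⟩ := hex b d
  let u : Fin n → ZMod q := Pi.single a 1 - Pi.single a' 1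
  let v : Fin n → ZMod q := Pi.single b 1 - Pi.single b' 1
  have hu : ∑ i, u i = 0 := by simp [u, sum_sub_distrib]
  have hv : ∑ i, v i = 0 := by simp [v, sum_sub_distrib]
  have hua : u a = 1 := by simp [u, ha'.symm]
  have hvb : v b = 1 := by simp [v, hb'.symm]
  have hcd : u c * v d = 0 := by
    by_cases hac : a = c
    · have hbd : b ≠ d := fun h => hef (by rw [hac, h])
      simp [v, hbd.symm, hdb'.symm]
    · simp [u, Ne.symm hac, hca'.symm]
  refine ⟨Matrix.vecMulVec u v, fun i => ?_, fun j => ?_, ?_⟩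
  · simp only [Matrix.vecMulVec_apply, ← mul_sum, hv, mul_zero]
  · simp only [Matrix.vecMulVec_apply, ← sum_mul, hu, zero_mul]
  · rw [pairChar_apply]
    simp only [Matrix.vecMulVec_apply, hua, hvb, hcd, mul_one, sub_zero]
    intro h
    rw [← AddChar.map_zero_eq_one (ZMod.stdAddChar (N := q))] at h
    exact one_ne_zero (ZMod.injective_stdAddChar h)

lemma sum_unifOmega {n q : ℕ} [NeZero q] {r c : Fin n → ZMod q}
    {x : Matrix (Fin n) (Fin n) (ZMod q)} (hx : x ∈ OmegaSet n q r c) :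
    ∑ z, unifOmega n q r c z = 1 := by
  have : (0 : ℝ) < (OmegaSet n q r c).card := by exact_mod_cast card_pos.mpr ⟨x, hx⟩
  simp only [unifOmega]
  rw [sum_ite_mem, univ_inter, sum_const, nsmul_eq_mul]
  field_simp

lemma unifOmega_nonneg {n q : ℕ} [NeZero q] (r c : Fin n → ZMod q)
    (z : Matrix (Fin n) (Fin n) (ZMod q)) : 0 ≤ unifOmega n q r c z := by
  unfold unifOmega; split_ifs <;> positivity

lemma sum_unifOmega_mul_pairChar {n q : ℕ} [NeZero q] (hn : 3 ≤ n) (hq : 2 ≤ q)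
    (r c : Fin n → ZMod q) (x : Matrix (Fin n) (Fin n) (ZMod q)) {e f : Fin n × Fin n}
    (hef : e ≠ f) : ∑ z, (unifOmega n q r c z : ℂ) * pairChar q e f (z - x) = 0 := by
  obtain ⟨g, hg1, hg2, hg⟩ := exists_table_zero_margins hn hq hef
  have hinv : ∀ z, unifOmega n q r c (z + g) = unifOmega n q r c z := by
    intro z
    have : z + g ∈ OmegaSet n q r c ↔ z ∈ OmegaSet n q r c := by
      simp [OmegaSet, sum_add_distrib, hg1, hg2]
    simp only [unifOmega, this]
  have h : ∑ z, (unifOmega n q r c z : ℂ) * pairChar q e f (z - x)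
      = (∑ z, (unifOmega n q r c z : ℂ) * pairChar q e f (z - x)) * pairChar q e f g := by
    conv_lhs => rw [← Equiv.sum_comp (Equiv.addRight g)]
    rw [sum_mul]
    refine sum_congr rfl fun z _ => ?_
    rw [Equiv.coe_addRight, hinv, add_sub_right_comm, AddChar.map_add_eq_mul, mul_assoc]
  by_contra h0
  exact hg (mul_left_cancel₀ h0 (by rw [mul_one]; exact h.symm))

lemma sum_unifOmega_mul_normSq {n q : ℕ} [NeZero q] (hn : 3 ≤ n) (hq : 2 ≤ q)
    {r c : Fin n → ZMod q} {x : Matrix (Fin n) (Fin n) (ZMod q)} (hx : x ∈ OmegaSet n q r c) :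
    ∑ z, unifOmega n q r c z * Complex.normSq (entrySum (z - x)) = (n : ℝ) ^ 2 := by
  have h := sum_mul_normSq_entrySum (unifOmega n q r c) x
  have h1 : ∀ e : Fin n × Fin n, ∑ f, ∑ z, (unifOmega n q r c z : ℂ) * pairChar q e f (z - x)
      = 1 := by
    intro e
    rw [sum_eq_single e (fun f _ hf => sum_unifOmega_mul_pairChar hn hq r c x hf.symm) (by simp)]
    simp only [pairChar_self, AddChar.one_apply, mul_one]
    exact_mod_cast sum_unifOmega hx
  rw [sum_congr rfl fun e _ => h1 e] at h
  simp only [sum_const, card_univ, Fintype.card_prod, Fintype.card_fin, nsmul_eq_mul,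
    mul_one] at h
  rw [sq]
  exact_mod_cast h

lemma sum_walkDist_mul_normSq {n q : ℕ} [NeZero q] (x : Matrix (Fin n) (Fin n) (ZMod q)) (t : ℕ) :
    ∑ z, walkDist n q x t z * Complex.normSq (entrySum (z - x))
      = ∑ e, ∑ f, stepCoeff (pairChar (n := n) q e f) ^ t := by
  have h := sum_mul_normSq_entrySum (walkDist n q x t) x
  simp_rw [sum_walkDist_mul] at h
  exact_mod_cast h

lemma sum_walkDist_mul_normSq_sub {n q : ℕ} [NeZero q] (hn : 2 ≤ n)
    (x : Matrix (Fin n) (Fin n) (ZMod q)) (t : ℕ) {m : ℝ}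
    (hm : m = (n : ℝ) ^ 2 * (1 - 4 * (1 - Real.cos (2 * Real.pi / q)) / (n : ℝ) ^ 2) ^ t) :
    ∑ z, walkDist n q x t z * Complex.normSq (entrySum (z - x) - m)
      = ∑ e, ∑ f, stepCoeff (pairChar (n := n) q e f) ^ t - m ^ 2 := by
  have hmean : ∑ z, (walkDist n q x t z : ℂ) * entrySum (z - x) = m := by
    simp_rw [entrySum, mul_sum]
    rw [sum_comm]
    simp_rw [sum_walkDist_mul, stepCoeff_entryChar hn]
    rw [hm, sum_const, card_univ, Fintype.card_prod, Fintype.card_fin, nsmul_eq_mul]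
    push_cast
    ring
  have hre : ∑ z, walkDist n q x t z * (entrySum (z - x)).re = m := by
    have := congrArg Complex.re hmean
    simpa only [Complex.re_sum, Complex.re_ofReal_mul, Complex.ofReal_re] using this
  have hexp : ∀ z, walkDist n q x t z * Complex.normSq (entrySum (z - x) - m)
      = walkDist n q x t z * Complex.normSq (entrySum (z - x))
        - 2 * m * (walkDist n q x t z * (entrySum (z - x)).re) + m ^ 2 * walkDist n q x t z := by
    intro z
    simp only [Complex.normSq_apply, Complex.sub_re, Complex.ofReal_re, Complex.sub_im,
        Complex.ofReal_im, sub_zero]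
    ring
  simp_rw [hexp]
  rw [sum_add_distrib, sum_sub_distrib, ← mul_sum, ← mul_sum, hre, sum_walkDist hn,
    sum_walkDist_mul_normSq]
  ring

lemma pow_le_sq_pow_mul_exp {a y κ L : ℝ} {t : ℕ} (ha : 0 ≤ a) (hy0 : 0 ≤ y) (hy : y ≤ 1 / 4)
    (hκ : 0 ≤ κ) (hL : t * y ≤ L) (hle : a ≤ 1 - 2 * y * (1 - κ)) :
    a ^ t ≤ ((1 - y) ^ t) ^ 2 * Real.exp (4 * (L * κ)) := by
  have hstep : a ≤ (1 - y) ^ 2 * Real.exp (4 * (y * κ)) := by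
    have h1 := Real.add_one_le_exp (4 * (y * κ))
    have h2 := mul_le_mul_of_nonneg_left h1 (sq_nonneg (1 - y))
    have h3 : 0 ≤ (y * κ) * (4 * (1 - y) ^ 2 - 2) :=
      mul_nonneg (mul_nonneg hy0 hκ) (by nlinarith)
    nlinarith
  calc a ^ t ≤ ((1 - y) ^ 2 * Real.exp (4 * (y * κ))) ^ t := pow_le_pow_left₀ ha hstep t
    _ = ((1 - y) ^ t) ^ 2 * Real.exp (t * (4 * (y * κ))) := by
        rw [mul_pow, pow_right_comm, Real.exp_nat_mul]
    _ ≤ _ := by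
        refine mul_le_mul_of_nonneg_left (Real.exp_le_exp.mpr ?_) (sq_nonneg _)
        nlinarith [mul_le_mul_of_nonneg_right hL hκ]

lemma exp_four_le : Real.exp 4 ≤ 55 := by
  have h := Real.exp_one_lt_d9
  have h4 : Real.exp 4 = Real.exp 1 ^ 4 := by rw [← Real.exp_nat_mul]; norm_num
  rw [h4]
  exact (pow_le_pow_left₀ (Real.exp_pos 1).le h.le 4).trans (by norm_num)

lemma stepCoeff_pairChar_pow_le {n q : ℕ} [NeZero q] (hn : 5 ≤ n) {t : ℕ} {y : ℝ}
    (hy : y = 4 * (1 - Real.cos (2 * Real.pi / q)) / (n : ℝ) ^ 2) (hy4 : y ≤ 1 / 4)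
    (hL : t * y ≤ Real.log n) (e f : Fin n × Fin n) :
    stepCoeff (pairChar q e f) ^ t ≤ (if e = f then 1 else 0) + ((1 - y) ^ t) ^ 2 *
      ((if e.1 = f.1 then 55 else 0) + (if e.2 = f.2 then 55 else 0) + (1 + 16 / n)) := by
  have hn' : (5 : ℝ) ≤ n := by exact_mod_cast hn
  by_cases hef : e = f
  · subst hef
    rw [pairChar_self, stepCoeff_one (by omega), one_pow, if_pos rfl]
    have : 0 ≤ ((1 - y) ^ t) ^ 2 * ((if e.1 = e.1 then (55 : ℝ) else 0) +
      (if e.2 = e.2 then 55 else 0) + (1 + 16 / n)) := by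
      refine mul_nonneg (sq_nonneg _) ?_
      simp only [if_true]
      positivity
    linarith
  have hy0 : 0 ≤ y := by
    rw [hy]
    exact div_nonneg (by linarith [Real.cos_le_one (2 * Real.pi / q)]) (sq_nonneg _)
  have hlog : Real.log n ≤ (n : ℝ) - 1 := Real.log_le_sub_one_of_pos (by linarith)
  have hpos : (0 : ℝ) < (n : ℝ) - 1 := by linarith
  have hbase := stepCoeff_pair_le (q := q) (by omega : 2 ≤ n) e f
  rw [← hy] at hbase
  have hnn := stepCoeff_pair_nonneg (q := q) (by omega : 4 ≤ n) e f
  have hpc : ∀ a c : Fin n, 0 ≤ pairCount a c := by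
    intro a c; unfold pairCount; split_ifs <;> linarith
  refine (pow_le_sq_pow_mul_exp hnn hy0 hy4
    (div_nonneg (mul_nonneg (hpc _ _) (hpc _ _)) (sq_nonneg _)) hL hbase).trans ?_
  rw [if_neg hef, zero_add]
  refine mul_le_mul_of_nonneg_left ?_ (sq_nonneg _)
  have h16 : (0 : ℝ) ≤ 16 / n := by positivity
  have hone : Real.exp (4 * (Real.log n * ((n - 1) / (n - 1) ^ 2))) ≤ 55 := by
    refine le_trans (Real.exp_le_exp.mpr ?_) exp_four_le
    have : Real.log n * (((n : ℝ) - 1) / (n - 1) ^ 2) ≤ 1 := by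
      rw [sq, div_mul_cancel_left₀ hpos.ne', ← div_eq_mul_inv, div_le_one hpos]
      exact hlog
    linarith
  unfold pairCount
  by_cases h1 : e.1 = f.1
  · have h2 : e.2 ≠ f.2 := fun h => hef (Prod.ext h1 h)
    rw [if_pos h1, if_neg h2, if_pos h1, if_neg h2, mul_one]
    linarith
  by_cases h2 : e.2 = f.2
  · rw [if_neg h1, if_pos h2, if_neg h1, if_pos h2, one_mul]
    linarith
  rw [if_neg h1, if_neg h2, if_neg h1, if_neg h2, one_mul, zero_add, zero_add]
  set ε : ℝ := 4 / ((n : ℝ) - 1) with hε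
  have hε0 : 0 ≤ ε := by positivity
  have hε1 : ε ≤ 1 := by rw [hε, div_le_one hpos]; linarith
  have hle : 4 * (Real.log n * (1 / (n - 1) ^ 2)) ≤ ε := by
    rw [hε, mul_one_div, ← mul_div_assoc, div_le_div_iff₀ (by positivity) hpos]
    nlinarith [mul_le_mul_of_nonneg_right hlog hpos.le]
  have hexp := Real.abs_exp_sub_one_le (x := ε) (by rwa [abs_of_nonneg hε0])
  rw [abs_of_nonneg hε0] at hexp
  have h8 : 2 * ε ≤ 16 / n := by
    rw [hε, ← mul_div_assoc, div_le_div_iff₀ hpos (by linarith)]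
    linarith
  linarith [Real.exp_le_exp.mpr hle, le_abs_self (Real.exp ε - 1)]

lemma sum_stepCoeff_pairChar_pow_le {n q : ℕ} [NeZero q] (hn : 5 ≤ n) {t : ℕ} {y : ℝ}
    (hy : y = 4 * (1 - Real.cos (2 * Real.pi / q)) / (n : ℝ) ^ 2) (hy4 : y ≤ 1 / 4)
    (hL : t * y ≤ Real.log n) :
    ∑ e, ∑ f, stepCoeff (pairChar (n := n) q e f) ^ t ≤
      (n : ℝ) ^ 2 + ((1 - y) ^ t) ^ 2 * ((n : ℝ) ^ 4 + 126 * (n : ℝ) ^ 3) := by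
  refine (sum_le_sum fun e _ => sum_le_sum fun f _ =>
    stepCoeff_pairChar_pow_le hn hy hy4 hL e f).trans (le_of_eq ?_)
  have hn0 : (n : ℝ) ≠ 0 := by exact_mod_cast (by omega : n ≠ 0)
  have hrow : ∀ e : Fin n × Fin n, ∑ f : Fin n × Fin n, (if e.1 = f.1 then (55 : ℝ) else 0)
      = 55 * n := by
    intro e
    rw [Fintype.sum_prod_type, sum_comm]
    simp [mul_comm]
  have hcol : ∀ e : Fin n × Fin n, ∑ f : Fin n × Fin n, (if e.2 = f.2 then (55 : ℝ) else 0)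
      = 55 * n := by
    intro e
    rw [Fintype.sum_prod_type]
    simp [mul_comm]
  simp_rw [sum_add_distrib, ← mul_sum, sum_add_distrib, hrow, hcol]
  simp only [sum_ite_eq, mem_univ, if_true, sum_const, card_univ, Fintype.card_prod,
    Fintype.card_fin, nsmul_eq_mul]
  push_cast
  field_simp
  ring

lemma exp_le_mul_one_sub_pow {N y D : ℝ} {t : ℕ} (hN : 16 ≤ N) (hy0 : 0 ≤ y)
    (hy : y ≤ 8 / N ^ 2) (hL : t * y ≤ Real.log N - D) (hD : 0 ≤ D) :
    Real.exp (D - 1) ≤ N * (1 - y) ^ t := by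
  have hN0 : 0 < N := by linarith
  have hyN : y * N ≤ 1 / 2 := by
    rw [le_div_iff₀ (by positivity)] at hy
    nlinarith [mul_nonneg hy0 hN0.le]
  have hy2 : y ≤ 1 / 2 := by nlinarith
  have h1 : Real.exp (-(y + 2 * y ^ 2)) ≤ 1 - y := by
    have h := Real.add_one_le_exp (y + 2 * y ^ 2)
    rw [Real.exp_neg, inv_le_comm₀ (Real.exp_pos _) (by linarith)]
    refine le_trans ?_ h
    rw [inv_le_iff_one_le_mul₀ (by linarith)]
    nlinarith [mul_nonneg (sq_nonneg y) (by linarith : 0 ≤ 1 - 2 * y)]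
  have hlog : Real.log N ≤ N := (Real.log_le_sub_one_of_pos hN0).trans (by linarith)
  have h2 : t * (y + 2 * y ^ 2) ≤ Real.log N - D + 1 := by
    have : t * y * y ≤ N * y := mul_le_mul_of_nonneg_right (by linarith) hy0
    nlinarith
  calc Real.exp (D - 1) = N * Real.exp (-(Real.log N - D + 1)) := by
        nth_rewrite 1 [← Real.exp_log hN0]
        rw [← Real.exp_add]; ring_nf
    _ ≤ N * Real.exp (t * -(y + 2 * y ^ 2)) := by
        refine mul_le_mul_of_nonneg_left (Real.exp_le_exp.mpr ?_) hN0.le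
        linarith
    _ = N * Real.exp (-(y + 2 * y ^ 2)) ^ t := by rw [Real.exp_nat_mul]
    _ ≤ N * (1 - y) ^ t :=
        mul_le_mul_of_nonneg_left (pow_le_pow_left₀ (Real.exp_pos _).le h1 t) hN0.le

lemma second_moment_ratio_le {N p w Q : ℝ} (hw1 : w ≤ 1) (hw : 0 < w)
    (hQ : Q * w = 4096) (hNQ : Q ≤ N) (hp : Q / 3 ≤ N * p) :
    2 / (N ^ 2 * p) ^ 2 * (N ^ 2 + (N ^ 2 + p ^ 2 * (N ^ 4 + 126 * N ^ 3) - (N ^ 2 * p) ^ 2))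
      ≤ w := by
  have hQ0 : 0 < Q := by
    by_contra h
    nlinarith
  have hQ1 : 4096 ≤ Q := by nlinarith
  have hN0 : 0 < N := by linarith
  have hp0 : 0 < N * p := by linarith
  have hpp : 0 < p := pos_of_mul_pos_right hp0 hN0.le
  have heq : 2 / (N ^ 2 * p) ^ 2 *
      (N ^ 2 + (N ^ 2 + p ^ 2 * (N ^ 4 + 126 * N ^ 3) - (N ^ 2 * p) ^ 2))
      = 4 / (N * p) ^ 2 + 252 / N := by
    field_simp
    ring
  have h1 : 4 / (N * p) ^ 2 ≤ w / 2 := by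
    rw [div_le_div_iff₀ (by positivity) (by norm_num)]
    have hsq : (Q / 3) ^ 2 ≤ (N * p) ^ 2 := pow_le_pow_left₀ (by positivity) hp 2
    have := mul_le_mul_of_nonneg_left hsq hw.le
    nlinarith
  have h2 : 252 / N ≤ w / 2 := by
    rw [div_le_div_iff₀ hN0 (by norm_num)]
    nlinarith [mul_le_mul_of_nonneg_right hNQ hw.le]
  rw [heq]
  linarith

theorem stmt1 (n q : ℕ) [NeZero q] (hn : 4 ≤ n) (hq : 2 ≤ q)
    (r c : Fin n → ZMod q) (hrc : ∑ i, r i = ∑ j, c j)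
    (x : Matrix (Fin n) (Fin n) (ZMod q)) (hx : x ∈ OmegaSet n q r c)
    (C : ℝ) (hC : 0 ≤ C)
    (t : ℕ)
    (ht : (t : ℝ) ≤ (n : ℝ) ^ 2 / (4 * (1 - Real.cos (2 * Real.pi / q))) * Real.log n
        - (n : ℝ) ^ 2 / (4 * (1 - Real.cos (2 * Real.pi / q))) * (C + 12) * Real.log q) :
    1 - (q : ℝ) ^ (-C) ≤ tvDist (walkDist n q x t) (unifOmega n q r c) := by
  have hq2 : (2 : ℝ) ≤ q := by exact_mod_cast hq
  have hn4 : (4 : ℝ) ≤ n := by exact_mod_cast hn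
  have hq0 : (0 : ℝ) < q := by linarith
  have hs0 : 0 < 1 - Real.cos (2 * Real.pi / q) := by
    have hpos : 0 < 2 * Real.pi / q := by positivity
    have hle : 2 * Real.pi / q ≤ Real.pi := by
      rw [div_le_iff₀ hq0]; nlinarith [Real.pi_pos]
    have := Real.cos_lt_cos_of_nonneg_of_le_pi le_rfl hle hpos
    rw [Real.cos_zero] at this
    linarith
  set s := 1 - Real.cos (2 * Real.pi / q) with hs
  have hs2 : s ≤ 2 := by linarith [Real.neg_one_le_cos (2 * Real.pi / q)]
  set D := (C + 12) * Real.log q with hD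
  have hlogq : 0 < Real.log q := Real.log_pos (by linarith)
  have hD0 : 0 ≤ D := by positivity
  set y := 4 * s / (n : ℝ) ^ 2 with hy
  have hy0 : 0 ≤ y := by positivity
  have hty : t * y ≤ Real.log n - D := by
    have h := mul_le_mul_of_nonneg_right ht hy0
    refine h.trans (le_of_eq ?_)
    rw [hy, hD]
    field_simp
  have hDn : D ≤ Real.log n := by
    have : 0 ≤ t * y := by positivity
    linarith
  have hexpD : Real.exp D = (q : ℝ) ^ (C + 12) := by
    rw [Real.rpow_def_of_pos hq0, hD, mul_comm]
  -- The time bound forces `n` to be large: `2 ^ 12 * q ^ C ≤ q ^ (C + 12) ≤ n`.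
  have hQw : (4096 * (q : ℝ) ^ C) * (q : ℝ) ^ (-C) = 4096 := by
    rw [mul_assoc, ← Real.rpow_add hq0]; simp
  have hQD : 4096 * (q : ℝ) ^ C ≤ Real.exp D := by
    have h12 : (4096 : ℝ) ≤ (q : ℝ) ^ (12 : ℝ) := by
      have := pow_le_pow_left₀ (by norm_num) hq2 12
      have h' : (q : ℝ) ^ (12 : ℝ) = (q : ℝ) ^ (12 : ℕ) := by exact_mod_cast Real.rpow_natCast q 12
      rw [h']
      linarith
    rw [hexpD, Real.rpow_add hq0, mul_comm]
    exact mul_le_mul_of_nonneg_left h12 (by positivity)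
  have hDN : Real.exp D ≤ n := by
    rw [← Real.exp_log (by linarith : (0 : ℝ) < n)]
    exact Real.exp_le_exp.mpr hDn
  have hqC : 1 ≤ (q : ℝ) ^ C := Real.one_le_rpow (by linarith) hC
  have hnbig : (4096 : ℝ) ≤ n := by linarith
  have hn5 : 5 ≤ n := by exact_mod_cast (by linarith : (5 : ℝ) ≤ n)
  have hy8 : y ≤ 8 / (n : ℝ) ^ 2 := div_le_div_of_nonneg_right (by linarith) (sq_nonneg _)
  have hy4 : y ≤ 1 / 4 := by
    refine hy8.trans ?_
    rw [div_le_div_iff₀ (by positivity) (by norm_num)]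
    nlinarith
  have hmean := exp_le_mul_one_sub_pow (by linarith) hy0 hy8 hty hD0
  have hQ3 : 4096 * (q : ℝ) ^ C / 3 ≤ n * (1 - y) ^ t := by
    refine le_trans ?_ hmean
    rw [Real.exp_sub]
    exact div_le_div₀ (Real.exp_pos D).le hQD (Real.exp_pos 1)
      (Real.exp_one_lt_d9.le.trans (by norm_num))
  have hm : 0 < (n : ℝ) ^ 2 * (1 - y) ^ t :=
    mul_pos (by positivity) (pow_pos (by linarith) t)
  have htv := one_sub_le_tvDist (walkDist_nonneg x t) (unifOmega_nonneg r c)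
    (sum_walkDist (by omega) x t) (sum_unifOmega hx) (fun z => entrySum (z - x)) hm
  rw [sum_unifOmega_mul_normSq (by omega) hq hx,
    sum_walkDist_mul_normSq_sub (by omega) x t rfl] at htv
  refine le_trans ?_ htv
  refine sub_le_sub_left (le_trans ?_ (second_moment_ratio_le
    (Real.rpow_le_one_of_one_le_of_nonpos (by linarith) (by linarith))
    (Real.rpow_pos_of_pos hq0 _) hQw (hQD.trans hDN) hQ3)) 1
  refine mul_le_mul_of_nonneg_left ?_ (by positivity)
  have := sum_stepCoeff_pairChar_pow_le (q := q) hn5 hy hy4 (by linarith : t * y ≤ Real.log n)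
  linarith
end

section
/- Let n ≥ 2 and q ≥ 2 be integers, and let φ : G → (ℤ/qℤ)^{(n−1)×(n−1)} be the coordinate map with respect to the basis {B_{i,j}}, i.e. the map determined by g = Σ_{i,j} φ(g)_{i,j}·B_{i,j} for all g ∈ G. Then for every (n−1)×(n−1) matrix y over ℤ/qℤ, Σ_{g ∈ G} μ(g)·exp(2πi·⟨φ(g), y⟩/q) = λ_y (an equality of complex numbers, the right-hand side being real). -/
/-- The matrix `B_{i,j}` (1-based indices). -/
def Bmat (n q : ℕ) (i j : ℕ) : Matrix (Fin n) (Fin n) (ZMod q) :=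
  Matrix.of fun a b =>
    (if (a : ℕ) + 1 = i ∧ (b : ℕ) + 1 = j then (1 : ZMod q) else 0)
  + (if (a : ℕ) = i ∧ (b : ℕ) = j then 1 else 0)
  - (if (a : ℕ) + 1 = i ∧ (b : ℕ) = j then 1 else 0)
  - (if (a : ℕ) = i ∧ (b : ℕ) + 1 = j then 1 else 0)

/-- The matrix `Ã_{i,j,k,l}` (1-based indices): entry 1 at `(a,c)` iff
`i ≤ a ≤ j` and `k ≤ c ≤ l`. -/
def Atil (n q : ℕ) (i j k l : ℕ) : Matrix (Fin (n - 1)) (Fin (n - 1)) (ZMod q) :=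
  Matrix.of fun a c =>
    if (i ≤ (a : ℕ) + 1 ∧ (a : ℕ) + 1 ≤ j) ∧ (k ≤ (c : ℕ) + 1 ∧ (c : ℕ) + 1 ≤ l)
      then (1 : ZMod q) else 0

/-- Inner product `⟨y, z⟩ = Σ_{a,c} y(a,c)·z(a,c)` in `ℤ/qℤ`. -/
def inner2 {m q : ℕ} (y z : Matrix (Fin m) (Fin m) (ZMod q)) : ZMod q :=
  ∑ a, ∑ c, y a c * z a c

/-- `cos(2πa/q)` for `a ∈ ℤ/qℤ`. -/
noncomputable def zcos (q : ℕ) (a : ZMod q) : ℝ :=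
  Real.cos (2 * Real.pi * (a.val : ℝ) / q)

/-- `exp(2πi·a/q)` for `a ∈ ℤ/qℤ`. -/
noncomputable def zexp (q : ℕ) (a : ZMod q) : ℂ :=
  Complex.exp (2 * (Real.pi : ℂ) * Complex.I * (a.val : ℂ) / (q : ℂ))

/-- The eigenvalue `λ_y`. -/
noncomputable def lamEig (n q : ℕ) (y : Matrix (Fin (n - 1)) (Fin (n - 1)) (ZMod q)) : ℝ :=
  (1 / (n.choose 2 : ℝ) ^ 2) *
    ∑ i ∈ Finset.Icc 1 (n - 1), ∑ j ∈ Finset.Icc i (n - 1),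
      ∑ k ∈ Finset.Icc 1 (n - 1), ∑ l ∈ Finset.Icc k (n - 1),
        zcos q (inner2 y (Atil n q i j k l))

/-- The group `G`, as a `ℤ/qℤ`-submodule of the `n × n` matrices. -/
def Gmod (n q : ℕ) : Submodule (ZMod q) (Matrix (Fin n) (Fin n) (ZMod q)) where
  carrier := {y | (∀ i, ∑ j, y i j = 0) ∧ (∀ j, ∑ i, y i j = 0)}
  zero_mem' := ⟨fun i => by simp, fun j => by simp⟩
  add_mem' := by
    intro a b ha hb
    obtain ⟨ha1, ha2⟩ := ha
    obtain ⟨hb1, hb2⟩ := hb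
    refine ⟨fun i => ?_, fun j => ?_⟩
    · simp [Matrix.add_apply, Finset.sum_add_distrib, ha1 i, hb1 i]
    · simp [Matrix.add_apply, Finset.sum_add_distrib, ha2 j, hb2 j]
  smul_mem' := by
    intro t a ha
    obtain ⟨ha1, ha2⟩ := ha
    refine ⟨fun i => ?_, fun j => ?_⟩
    · simp [Matrix.smul_apply, smul_eq_mul, ← Finset.mul_sum, ha1 i]
    · simp [Matrix.smul_apply, smul_eq_mul, ← Finset.mul_sum, ha2 j]

/-- The discrete rectangle sum of `g` over the entries weakly north-west of `(a, c)`. -/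
def cornerSum {n q : ℕ} (g : Matrix (Fin n) (Fin n) (ZMod q)) (a c : ℕ) : ZMod q :=
  ∑ x : Fin n, ∑ z : Fin n, if (x : ℕ) ≤ a ∧ (z : ℕ) ≤ c then g x z else 0

lemma Bmat_eq_DGmat (n q i j : ℕ) : Bmat n q i j = DGmat n q i (i + 1) j (j + 1) := by
  ext a b
  simp [Bmat, DGmat]

lemma DGmat_apply (n q i j k l : ℕ) (a b : Fin n) :
    DGmat n q i j k l a b =
      ((if (a : ℕ) + 1 = i then (1 : ZMod q) else 0) - if (a : ℕ) + 1 = j then 1 else 0) *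
      ((if (b : ℕ) + 1 = k then (1 : ZMod q) else 0) - if (b : ℕ) + 1 = l then 1 else 0) := by
  simp only [DGmat, Matrix.of_apply, ite_and]
  split_ifs <;> ring

lemma sum_fin_succ_eq_ite {n q : ℕ} {i : ℕ} (hi : i ∈ Finset.Icc 1 n) (P : ℕ → Prop)
    [DecidablePred P] :
    (∑ x : Fin n, if P x then (if (x : ℕ) + 1 = i then (1 : ZMod q) else 0) else 0) =
      if P (i - 1) then 1 else 0 := by
  rw [Finset.mem_Icc] at hi
  rw [Finset.sum_eq_single ⟨i - 1, by omega⟩]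
  · simp [Nat.sub_add_cancel hi.1]
  · intro b _ hb
    have : (b : ℕ) + 1 ≠ i := fun h => hb (Fin.ext (by simp; omega))
    simp [this]
  · simp

lemma cornerSum_DGmat {n q i j k l : ℕ} (hi : i ∈ Finset.Icc 1 n) (hj : j ∈ Finset.Icc 1 n)
    (hk : k ∈ Finset.Icc 1 n) (hl : l ∈ Finset.Icc 1 n) (a c : ℕ) :
    cornerSum (DGmat n q i j k l) a c =
      ((if i - 1 ≤ a then (1 : ZMod q) else 0) - if j - 1 ≤ a then 1 else 0) *
      ((if k - 1 ≤ c then (1 : ZMod q) else 0) - if l - 1 ≤ c then 1 else 0) := by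
  rw [← sum_fin_succ_eq_ite hi (· ≤ a), ← sum_fin_succ_eq_ite hj (· ≤ a),
    ← sum_fin_succ_eq_ite hk (· ≤ c), ← sum_fin_succ_eq_ite hl (· ≤ c),
    ← Finset.sum_sub_distrib, ← Finset.sum_sub_distrib, Finset.sum_mul_sum, cornerSum]
  refine Finset.sum_congr rfl fun x _ => Finset.sum_congr rfl fun z _ => ?_
  rw [DGmat_apply]
  by_cases h1 : (x : ℕ) ≤ a <;> by_cases h2 : (z : ℕ) ≤ c <;> simp [h1, h2]

lemma cornerSum_sum {n q : ℕ} {ι : Type*} (s : Finset ι)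
    (f : ι → Matrix (Fin n) (Fin n) (ZMod q)) (a c : ℕ) :
    cornerSum (∑ i ∈ s, f i) a c = ∑ i ∈ s, cornerSum (f i) a c := by
  simp only [cornerSum, Matrix.sum_apply]
  symm
  rw [Finset.sum_comm]
  refine Finset.sum_congr rfl fun x _ => ?_
  rw [Finset.sum_comm]
  refine Finset.sum_congr rfl fun z _ => ?_
  split_ifs <;> simp

lemma cornerSum_smul {n q : ℕ} (t : ZMod q) (g : Matrix (Fin n) (Fin n) (ZMod q)) (a c : ℕ) :
    cornerSum (t • g) a c = t * cornerSum g a c := by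
  simp [cornerSum, Finset.mul_sum]

lemma cornerSum_neg {n q : ℕ} (g : Matrix (Fin n) (Fin n) (ZMod q)) (a c : ℕ) :
    cornerSum (-g) a c = -cornerSum g a c := by
  simpa using cornerSum_smul (-1) g a c

lemma cornerSum_Bmat {n q : ℕ} (i j a c : Fin (n - 1)) :
    cornerSum (Bmat n q ((i : ℕ) + 1) ((j : ℕ) + 1)) a c =
      if a = i ∧ c = j then 1 else 0 := by
  have hi := i.2
  have hj := j.2
  rw [Bmat_eq_DGmat, cornerSum_DGmat (by simp; omega) (by simp; omega) (by simp; omega)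
    (by simp; omega)]
  simp only [Fin.ext_iff]
  split_ifs <;> first | omega | simp

lemma cornerSum_sum_smul_Bmat {n q : ℕ} (w : Matrix (Fin (n - 1)) (Fin (n - 1)) (ZMod q))
    (a c : Fin (n - 1)) :
    cornerSum (∑ i : Fin (n - 1), ∑ j : Fin (n - 1),
      w i j • Bmat n q ((i : ℕ) + 1) ((j : ℕ) + 1)) a c = w a c := by
  simp [cornerSum_sum, cornerSum_smul, cornerSum_Bmat, ite_and]

lemma cornerSum_DGmat_eq_Atil {n q i j k l : ℕ} (hi : i ∈ Finset.Icc 1 n)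
    (hj : j ∈ Finset.Icc 1 n) (hk : k ∈ Finset.Icc 1 n) (hl : l ∈ Finset.Icc 1 n)
    (hij : i < j) (hkl : k < l) (a c : Fin (n - 1)) :
    cornerSum (DGmat n q i j k l) a c = Atil n q i (j - 1) k (l - 1) a c := by
  rw [cornerSum_DGmat hi hj hk hl]
  simp only [Finset.mem_Icc] at hi hj hk hl
  simp only [Atil, Matrix.of_apply]
  split_ifs <;> first | omega | simp

lemma DGmat_mem_Gmod {n q i j k l : ℕ} (hi : i ∈ Finset.Icc 1 n) (hj : j ∈ Finset.Icc 1 n)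
    (hk : k ∈ Finset.Icc 1 n) (hl : l ∈ Finset.Icc 1 n) :
    DGmat n q i j k l ∈ Gmod n q := by
  have key {m : ℕ} (hm : m ∈ Finset.Icc 1 n) :
      (∑ x : Fin n, if (x : ℕ) + 1 = m then (1 : ZMod q) else 0) = 1 := by
    simpa using sum_fin_succ_eq_ite (q := q) hm (fun _ => True)
  refine ⟨fun a => ?_, fun b => ?_⟩
  · simp only [DGmat_apply]
    rw [← Finset.mul_sum, Finset.sum_sub_distrib, key hk, key hl, sub_self, mul_zero]
  · simp only [DGmat_apply]
    rw [← Finset.sum_mul, Finset.sum_sub_distrib, key hi, key hj, sub_self, zero_mul]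

lemma zexp_add_zexp_neg {q : ℕ} [NeZero q] (a : ZMod q) :
    zexp q a + zexp q (-a) = 2 * (zcos q a : ℂ) := by
  have hq : (q : ℂ) ≠ 0 := Nat.cast_ne_zero.mpr (NeZero.ne q)
  have hneg : zexp q (-a) =
      Complex.exp (-(2 * (Real.pi : ℂ) * (a.val : ℂ) / (q : ℂ)) * Complex.I) := by
    rw [zexp, ZMod.neg_val]
    split_ifs with h
    · simp [h]
    · rw [Nat.cast_sub a.val_lt.le, 
        ← Complex.exp_periodic.sub_eq (2 * (Real.pi : ℂ) * Complex.I * _ / _)]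
      congr 1
      field_simp
      ring
  rw [hneg, zcos, zexp]
  push_cast
  rw [Complex.two_cos]
  congr 2
  ring

lemma sum_Icc_lt_eq_sum_Icc {M : Type*} [AddCommMonoid M] (n : ℕ) (f : ℕ → ℕ → M) :
    ∑ p ∈ (Finset.Icc 1 n ×ˢ Finset.Icc 1 n).filter (fun p => p.1 < p.2), f p.1 (p.2 - 1) =
      ∑ i ∈ Finset.Icc 1 (n - 1), ∑ j ∈ Finset.Icc i (n - 1), f i j := by
  rw [Finset.sum_sigma']
  refine Finset.sum_bij' (fun p _ => ⟨p.1, p.2 - 1⟩) (fun p _ => (p.1, p.2 + 1)) ?_ ?_ ?_ ?_ ?_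
  · simp; omega
  · simp; omega
  · simp; omega
  · simp
  · simp

lemma sum_card_filter_mul {ι α : Type*} [DecidableEq α] (s : Finset ι) (t : Finset α)
    (A : ι → α) (hA : ∀ p ∈ s, A p ∈ t) (F : α → ℂ) :
    ∑ g ∈ t, ((s.filter (fun p => A p = g)).card : ℂ) * F g = ∑ p ∈ s, F (A p) := by
  rw [← Finset.sum_fiberwise_of_maps_to hA]
  refine Finset.sum_congr rfl fun g _ => ?_
  rw [← nsmul_eq_mul, ← Finset.sum_const]
  exact Finset.sum_congr rfl fun p hp => by rw [(Finset.mem_filter.mp hp).2]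

/-- The ordered index pairs `i < j` in `{1, …, n}`. -/
def ltPairs (n : ℕ) : Finset (ℕ × ℕ) :=
  (Finset.Icc 1 n ×ˢ Finset.Icc 1 n).filter (fun p => p.1 < p.2)

/-- The signed step `±A_{i,j,k,l}` attached to a pair of rows, a pair of columns and a sign. -/
def signedStep (n q : ℕ) (p : ((ℕ × ℕ) × (ℕ × ℕ)) × Bool) : Matrix (Fin n) (Fin n) (ZMod q) :=
  if p.2 then DGmat n q p.1.1.1 p.1.1.2 p.1.2.1 p.1.2.2
  else -DGmat n q p.1.1.1 p.1.1.2 p.1.2.1 p.1.2.2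

lemma stepPMF_eq (n q : ℕ) (g : Matrix (Fin n) (Fin n) (ZMod q)) :
    stepPMF n q g =
      ((((ltPairs n ×ˢ ltPairs n) ×ˢ (Finset.univ : Finset Bool)).filter
        (fun p => signedStep n q p = g)).card : ℝ) / (2 * (n.choose 2 : ℝ) ^ 2) := by
  rw [stepPMF]
  congr 3
  ext p
  rw [Finset.mem_filter, Finset.mem_filter]
  simp only [ltPairs, signedStep, Finset.mem_filter, Finset.mem_product]
  tauto

lemma inner2_comm {m q : ℕ} (y z : Matrix (Fin m) (Fin m) (ZMod q)) :
    inner2 y z = inner2 z y := by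
  simp [inner2, mul_comm]

lemma inner2_neg {m q : ℕ} (y z : Matrix (Fin m) (Fin m) (ZMod q)) :
    inner2 y (-z) = -inner2 y z := by
  simp [inner2]

open scoped Classical in
theorem stmt5 (n q : ℕ) [NeZero q] (hn : 2 ≤ n) (hq : 2 ≤ q)
    (φ : Matrix (Fin n) (Fin n) (ZMod q) → Matrix (Fin (n - 1)) (Fin (n - 1)) (ZMod q))
    (hφ : ∀ g ∈ Gmod n q,
        g = ∑ i : Fin (n - 1), ∑ j : Fin (n - 1),
              φ g i j • Bmat n q ((i : ℕ) + 1) ((j : ℕ) + 1))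
    (y : Matrix (Fin (n - 1)) (Fin (n - 1)) (ZMod q)) :
    ∑ g ∈ Finset.univ.filter (fun g : Matrix (Fin n) (Fin n) (ZMod q) => g ∈ Gmod n q),
        (stepPMF n q g : ℂ) * zexp q (inner2 (φ g) y) = (lamEig n q y : ℂ) := by
  have hφc : ∀ g ∈ Gmod n q, ∀ a c, φ g a c = cornerSum g a c := fun g hg a c => by
    conv_rhs => rw [hφ g hg]
    exact (cornerSum_sum_smul_Bmat (φ g) a c).symm
  have hmem : ∀ p ∈ ltPairs n ×ˢ ltPairs n,
      DGmat n q p.1.1 p.1.2 p.2.1 p.2.2 ∈ Gmod n q := by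
    intro p hp
    simp only [ltPairs, Finset.mem_product, Finset.mem_filter] at hp
    exact DGmat_mem_Gmod hp.1.1.1 hp.1.1.2 hp.2.1.1 hp.2.1.2
  have hφA : ∀ p ∈ ltPairs n ×ˢ ltPairs n,
      φ (DGmat n q p.1.1 p.1.2 p.2.1 p.2.2) = Atil n q p.1.1 (p.1.2 - 1) p.2.1 (p.2.2 - 1) := by
    intro p hp
    ext a c
    rw [hφc _ (hmem p hp)]
    simp only [ltPairs, Finset.mem_product, Finset.mem_filter] at hp
    exact cornerSum_DGmat_eq_Atil hp.1.1.1 hp.1.1.2 hp.2.1.1 hp.2.1.2 hp.1.2 hp.2.2 a c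
  have hφneg : ∀ g ∈ Gmod n q, φ (-g) = -φ g := by
    intro g hg
    ext a c
    rw [hφc _ (neg_mem hg), cornerSum_neg, Matrix.neg_apply, hφc _ hg]
  have hstep : ∀ p ∈ (ltPairs n ×ˢ ltPairs n) ×ˢ (Finset.univ : Finset Bool),
      signedStep n q p ∈ Finset.univ.filter
        (fun g : Matrix (Fin n) (Fin n) (ZMod q) => g ∈ Gmod n q) := by
    intro p hp
    have h := hmem p.1 (Finset.mem_product.mp hp).1
    rw [Finset.mem_filter]
    refine ⟨Finset.mem_univ _, ?_⟩
    rw [signedStep]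
    split_ifs
    exacts [h, neg_mem h]
  have hsum := sum_card_filter_mul _ _ _ hstep (fun g => zexp q (inner2 (φ g) y))
  have hpair : ∑ p ∈ (ltPairs n ×ˢ ltPairs n) ×ˢ (Finset.univ : Finset Bool),
      zexp q (inner2 (φ (signedStep n q p)) y) =
      ∑ p ∈ ltPairs n ×ˢ ltPairs n,
        2 * (zcos q (inner2 y (Atil n q p.1.1 (p.1.2 - 1) p.2.1 (p.2.2 - 1))) : ℂ) := by
    rw [Finset.sum_product]
    refine Finset.sum_congr rfl fun p hp => ?_
    rw [Fintype.sum_bool, ← zexp_add_zexp_neg, ← inner2_neg, ← hφA p hp,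
      ← hφneg _ (hmem p hp)]
    simp [signedStep, inner2_comm y]
  have hlam : ∑ i ∈ Finset.Icc 1 (n - 1), ∑ j ∈ Finset.Icc i (n - 1),
      ∑ k ∈ Finset.Icc 1 (n - 1), ∑ l ∈ Finset.Icc k (n - 1),
        zcos q (inner2 y (Atil n q i j k l)) =
      ∑ p ∈ ltPairs n ×ˢ ltPairs n,
        zcos q (inner2 y (Atil n q p.1.1 (p.1.2 - 1) p.2.1 (p.2.2 - 1))) := by
    rw [Finset.sum_product, ltPairs, ← sum_Icc_lt_eq_sum_Icc]
    refine Finset.sum_congr rfl fun p _ => ?_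
    rw [← sum_Icc_lt_eq_sum_Icc]
  have hC : (n.choose 2 : ℂ) ≠ 0 := Nat.cast_ne_zero.mpr (Nat.choose_pos hn).ne'
  calc _ = (∑ p ∈ (ltPairs n ×ˢ ltPairs n) ×ˢ (Finset.univ : Finset Bool),
        zexp q (inner2 (φ (signedStep n q p)) y)) / (2 * (n.choose 2 : ℂ) ^ 2) := by
        rw [← hsum, Finset.sum_div]
        refine Finset.sum_congr rfl fun g _ => ?_
        rw [stepPMF_eq]
        push_cast
        rw [div_mul_eq_mul_div]
    _ = _ := by
        rw [hpair, lamEig, hlam, ← Finset.mul_sum]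
        push_cast
        field_simp
end

section
/- Let n ≥ 3 and q ≥ 2 be integers. Then for every (n−1)×(n−1) matrix y over ℤ/qℤ, λ_y ≥ −28/29. -/
/-- The sum of `cos (x l - x (k - 1))` over all intervals `[k, l]` in `[1, m]`, in closed form. -/
theorem sum_cos_intervals (x : ℕ → ℝ) (m : ℕ) :
    ∑ k ∈ Finset.Icc 1 m, ∑ l ∈ Finset.Icc k m, Real.cos (x l - x (k - 1)) =
      ((∑ t ∈ Finset.range (m + 1), Real.cos (x t)) ^ 2 +
        (∑ t ∈ Finset.range (m + 1), Real.sin (x t)) ^ 2 - (m + 1)) / 2 := by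
  induction m with
  | zero => simp
  | succ m ih =>
    have extend : ∑ k ∈ Finset.Icc 1 (m + 1), ∑ l ∈ Finset.Icc k (m + 1),
          Real.cos (x l - x (k - 1)) =
        ∑ k ∈ Finset.Icc 1 m, ∑ l ∈ Finset.Icc k m, Real.cos (x l - x (k - 1)) +
          ∑ k ∈ Finset.Icc 1 (m + 1), Real.cos (x (m + 1) - x (k - 1)) := by
      have row : ∀ k ∈ Finset.Icc 1 (m + 1),
          ∑ l ∈ Finset.Icc k (m + 1), Real.cos (x l - x (k - 1)) =
            ∑ l ∈ Finset.Icc k m, Real.cos (x l - x (k - 1)) +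
              Real.cos (x (m + 1) - x (k - 1)) := fun k hk =>
        Finset.sum_Icc_succ_top (Finset.mem_Icc.1 hk).2 _
      rw [Finset.sum_congr rfl row, Finset.sum_add_distrib,
        Finset.sum_Icc_succ_top (Nat.le_add_left 1 m)
          (fun k => ∑ l ∈ Finset.Icc k m, Real.cos (x l - x (k - 1)))]
      simp
    have last : ∑ k ∈ Finset.Icc 1 (m + 1), Real.cos (x (m + 1) - x (k - 1)) =
        Real.cos (x (m + 1)) * ∑ t ∈ Finset.range (m + 1), Real.cos (x t) +
          Real.sin (x (m + 1)) * ∑ t ∈ Finset.range (m + 1), Real.sin (x t) := by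
      rw [← Finset.Ico_add_one_right_eq_Icc, Finset.sum_Ico_eq_sum_range, Finset.mul_sum,
        Finset.mul_sum, ← Finset.sum_add_distrib]
      refine Finset.sum_congr (by simp) fun t _ => ?_
      rw [Nat.add_sub_cancel_left, Real.cos_sub]
    rw [extend, last, ih, Finset.sum_range_succ _ (m + 1), Finset.sum_range_succ _ (m + 1)]
    push_cast
    linear_combination (-1 / 2 : ℝ) * Real.sin_sq_add_cos_sq (x (m + 1))

theorem sum_cos_intervals_ge (x : ℕ → ℝ) (m : ℕ) :
    -((m + 1 : ℝ) / 2) ≤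
      ∑ k ∈ Finset.Icc 1 m, ∑ l ∈ Finset.Icc k m, Real.cos (x l - x (k - 1)) := by
  rw [sum_cos_intervals]
  linarith [sq_nonneg (∑ t ∈ Finset.range (m + 1), Real.cos (x t)),
    sq_nonneg (∑ t ∈ Finset.range (m + 1), Real.sin (x t))]

theorem sum_intervals_one (m : ℕ) :
    ∑ k ∈ Finset.Icc 1 m, ∑ _l ∈ Finset.Icc k m, (1 : ℝ) = (m + 1) * m / 2 := by
  have h := sum_cos_intervals (fun _ => 0) m
  simp only [sub_self, Real.cos_zero, Real.sin_zero, Finset.sum_const_zero, Finset.sum_const,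
    Finset.card_range, nsmul_eq_mul, Nat.cast_add, Nat.cast_one, mul_one] at h ⊢
  rw [h]
  ring

theorem zcos_sub {q : ℕ} (hq : q ≠ 0) (u v : ZMod q) :
    zcos q (u - v) =
      Real.cos (2 * Real.pi * (u.val : ℝ) / q - 2 * Real.pi * (v.val : ℝ) / q) := by
  have : NeZero q := ⟨hq⟩
  have hdvd : (q : ℤ) ∣ ((u - v).val : ℤ) - ((u.val : ℤ) - v.val) := by
    rw [← ZMod.intCast_zmod_eq_zero_iff_dvd]
    simp
  obtain ⟨z, hz⟩ := hdvd
  have hz' : ((u - v).val : ℝ) = (u.val : ℝ) - v.val + q * z := by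
    have : (((u - v).val : ℤ) : ℝ) - (((u.val : ℤ) : ℝ) - ((v.val : ℤ) : ℝ)) = (q : ℝ) * z := by
      exact_mod_cast hz
    simp only [Int.cast_natCast] at this
    linarith
  have hq' : (q : ℝ) ≠ 0 := Nat.cast_ne_zero.2 hq
  rw [zcos, hz', ← Real.cos_add_int_mul_two_pi (_ - _) z]
  congr 1
  field_simp

theorem inner2_Atil_eq_sub {n q : ℕ} (y : Matrix (Fin (n - 1)) (Fin (n - 1)) (ZMod q))
    (i j : ℕ) {k l : ℕ} (hk : 1 ≤ k) (hkl : k ≤ l) :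
    inner2 y (Atil n q i j k l) =
      inner2 y (Atil n q i j 1 l) - inner2 y (Atil n q i j 1 (k - 1)) := by
  simp only [inner2, ← Finset.sum_sub_distrib, ← mul_sub]
  refine Finset.sum_congr rfl fun a _ => Finset.sum_congr rfl fun c _ => ?_
  congr 1
  simp only [Atil, Matrix.of_apply]
  split_ifs <;> first | omega | simp

theorem sum_zcos_columns_ge {n q : ℕ} (hn : 1 ≤ n) (hq : q ≠ 0)
    (y : Matrix (Fin (n - 1)) (Fin (n - 1)) (ZMod q)) (i j : ℕ) :
    -((n : ℝ) / 2) ≤ ∑ k ∈ Finset.Icc 1 (n - 1), ∑ l ∈ Finset.Icc k (n - 1),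
      zcos q (inner2 y (Atil n q i j k l)) := by
  have h := sum_cos_intervals_ge
    (fun t => 2 * Real.pi * ((inner2 y (Atil n q i j 1 t)).val : ℝ) / q) (n - 1)
  rw [Nat.cast_sub hn, Nat.cast_one, sub_add_cancel] at h
  refine h.trans_eq (Finset.sum_congr rfl fun k hk => Finset.sum_congr rfl fun l hl => ?_)
  rw [inner2_Atil_eq_sub y i j (Finset.mem_Icc.1 hk).1 (Finset.mem_Icc.1 hl).1, zcos_sub hq]

theorem lamEig_ge {n q : ℕ} (hn : 2 ≤ n) (hq : q ≠ 0)
    (y : Matrix (Fin (n - 1)) (Fin (n - 1)) (ZMod q)) :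
    -(1 / ((n : ℝ) - 1)) ≤ lamEig n q y := by
  have hn' : (2 : ℝ) ≤ n := by exact_mod_cast hn
  have hn1 : (0 : ℝ) < (n : ℝ) - 1 := by linarith
  have total : -((n : ℝ) / 2) * (n * (n - 1) / 2) ≤
      ∑ i ∈ Finset.Icc 1 (n - 1), ∑ j ∈ Finset.Icc i (n - 1),
        ∑ k ∈ Finset.Icc 1 (n - 1), ∑ l ∈ Finset.Icc k (n - 1),
          zcos q (inner2 y (Atil n q i j k l)) := by
    have count := sum_intervals_one (n - 1)
    rw [Nat.cast_sub (by omega : 1 ≤ n), Nat.cast_one, sub_add_cancel] at count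
    rw [← count, Finset.mul_sum]
    refine Finset.sum_le_sum fun i _ => ?_
    rw [Finset.mul_sum]
    refine Finset.sum_le_sum fun j _ => ?_
    rw [mul_one]
    exact sum_zcos_columns_ge (by omega) hq y i j
  rw [lamEig, Nat.cast_choose_two]
  refine le_trans (le_of_eq ?_) (mul_le_mul_of_nonneg_left total (by positivity))
  field_simp

theorem stmt7 (n q : ℕ) (hn : 3 ≤ n) (hq : 2 ≤ q)
    (y : Matrix (Fin (n - 1)) (Fin (n - 1)) (ZMod q)) :
    -(28 / 29 : ℝ) ≤ lamEig n q y := by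
  have hn' : (3 : ℝ) ≤ n := by exact_mod_cast hn
  have hhalf : 1 / ((n : ℝ) - 1) ≤ 1 / 2 :=
    one_div_le_one_div_of_le (by norm_num) (by linarith)
  linarith [lamEig_ge (by omega : 2 ≤ n) (by omega : q ≠ 0) y]
end
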